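/- arXiv:2308.02889 — 3 statements merged into one kernel-verified Lean document; each statement's English description precedes it below -/
import Mathlib

section
/- Let C₁,…,C_m ⊆ F_q^n be cyclic codes where C_i is defined by check polynomial p_i(x) dividing x^n − 1, i.e., C_i ≅ {a ∈ F_q[x] : deg a < n, p_i(x)·a(x) ≡ 0 mod (x^n − 1)}. Then the code C₁ ⊞ ⋯ ⊞ C_m := (C₁^⊥ ⊗ ⋯ ⊗ C_m^⊥)^⊥, viewed as multivariate polynomials, equals {a ∈ F_q[x₁,…,x_m] : deg_{x_i} a < n for all i, and a(x₁,…,x_m)·∏_{i=1}^m p_i(x_i) ≡ 0 mod (x₁^n − 1, …, x_m^n − 1)}. -/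
noncomputable section

open Polynomial

/-- Normalized Hamming weight. -/
def normWt {ι F : Type*} [Fintype ι] [Zero F] (x : ι → F) : ℝ :=
  (Nat.card {p : ι // x p ≠ 0} : ℝ) / (Fintype.card ι : ℝ)

/-- Normalized Hamming distance from a word to a set of words. -/
def distTo {ι F : Type*} [Fintype ι] [AddGroup F] (x : ι → F) (S : Set (ι → F)) : ℝ :=
  sInf ((fun c => normWt (x - c)) '' S)

/-- Normalized minimum distance of a code. -/
def minDist {ι F : Type*} [Fintype ι] [Zero F] (S : Set (ι → F)) : ℝ :=
  sInf (normWt '' (S \ {0}))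

/-- Restriction of a word on a grid to the axis-`i` line through `y`. -/
def lineRestrict {F : Type*} {m : ℕ} {n : Fin m → ℕ}
    (x : (∀ j, Fin (n j)) → F) (i : Fin m) (y : ∀ j, Fin (n j)) : Fin (n i) → F :=
  fun s => x (Function.update y i s)

/-- `‖x‖_i`: the fraction of axis-`i` parallel lines on which `x` is nonzero. -/
def lineWt {F : Type*} [Zero F] {m : ℕ} {n : Fin m → ℕ}
    (x : (∀ j, Fin (n j)) → F) (i : Fin m) : ℝ :=
  (Nat.card {y : ∀ j, Fin (n j) // lineRestrict x i y ≠ 0} : ℝ) /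
    (Fintype.card (∀ j, Fin (n j)) : ℝ)

/-- `C^{(i)}`: words all of whose axis-`i` lines belong to `C i`. -/
def axisCode {F : Type*} {m : ℕ} {n : Fin m → ℕ}
    (C : ∀ i, Set (Fin (n i) → F)) (i : Fin m) : Set ((∀ j, Fin (n j)) → F) :=
  {x | ∀ y, lineRestrict x i y ∈ C i}

/-- Tensor product code `C₁ ⊗ ⋯ ⊗ C_m`. -/
def prodCode {F : Type*} {m : ℕ} {n : Fin m → ℕ}
    (C : ∀ i, Set (Fin (n i) → F)) : Set ((∀ j, Fin (n j)) → F) :=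
  ⋂ i, axisCode C i

/-- Dual code w.r.t. the standard bilinear form. -/
def dualCode {ι F : Type*} [Fintype ι] [CommRing F] (S : Set (ι → F)) : Set (ι → F) :=
  {x | ∀ c ∈ S, ∑ p, x p * c p = 0}

/-- `C₁ ⊞ ⋯ ⊞ C_m := (C₁^⊥ ⊗ ⋯ ⊗ C_m^⊥)^⊥`. -/
def boxCode {F : Type*} [CommRing F] {m : ℕ} {n : Fin m → ℕ}
    (C : ∀ i, Set (Fin (n i) → F)) : Set ((∀ j, Fin (n j)) → F) :=
  dualCode (prodCode (fun i => dualCode (C i)))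

/-- `ρ`-product-expansion of a collection of codes. -/
def productExpanding {F : Type*} [Field F] {m : ℕ} {n : Fin m → ℕ}
    (C : ∀ i, Set (Fin (n i) → F)) (ρ : ℝ) : Prop :=
  ∀ c ∈ boxCode C, ∃ a : Fin m → ((∀ j, Fin (n j)) → F),
    (∀ i, a i ∈ axisCode C i) ∧ c = ∑ i, a i ∧
      ρ * ∑ i, lineWt (a i) i ≤ normWt c

/-- The product-expansion constant `ρ(𝒞)`. -/
def prodExpConst {F : Type*} [Field F] {m : ℕ} {n : Fin m → ℕ}
    (C : ∀ i, Set (Fin (n i) → F)) : ℝ :=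
  sSup {ρ : ℝ | productExpanding C ρ}

/-- Expected distance under the axis-parallel line test `T_m^1`. -/
def lineTestE {F : Type*} [Field F] {m : ℕ} {n : Fin m → ℕ}
    (C : ∀ i, Set (Fin (n i) → F)) (x : (∀ j, Fin (n j)) → F) : ℝ :=
  (∑ i, (∑ y : ∀ j, Fin (n j), distTo (lineRestrict x i y) (C i)) /
      (Fintype.card (∀ j, Fin (n j)) : ℝ)) / (m : ℝ)

/-- Robustness constant `ρ_r(T_m^1, ⊗𝒞)` of the axis-parallel line test. -/
def lineRobustConst {F : Type*} [Field F] {m : ℕ} {n : Fin m → ℕ}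
    (C : ∀ i, Set (Fin (n i) → F)) : ℝ :=
  sSup {α : ℝ | ∀ x, α * distTo x (prodCode C) ≤ lineTestE C x}

/-- Agreement-testability constant `ρ_a(⊗𝒞)`. -/
def agreeConst {F : Type*} [Field F] {m : ℕ} {n : Fin m → ℕ}
    (C : ∀ i, Set (Fin (n i) → F)) : ℝ :=
  sSup {α : ℝ | ∀ c : Fin m → ((∀ j, Fin (n j)) → F),
    (∀ i, c i ∈ axisCode C i) → ∃ z ∈ prodCode C,
      α * ((∑ i, lineWt (c i - z) i) / (m : ℝ)) ≤
        (∑ i, ∑ j, normWt (c i - c j)) / ((m : ℝ) ^ 2)}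

/-- `C^{⊗k}` on the grid `[n]^k`. -/
def tensorPow {F : Type*} {n : ℕ} (C : Set (Fin n → F)) (k : ℕ) :
    Set ((Fin k → Fin n) → F) :=
  {x | ∀ (i : Fin k) (y : Fin k → Fin n), (fun s => x (Function.update y i s)) ∈ C}

/-- Restriction of a word to the axis-parallel `k`-flat determined by the axes
`e : Fin k ↪ Fin m` and base point `y`. -/
def flatRestrict {F : Type*} {n m k : ℕ} (x : (Fin m → Fin n) → F)
    (e : Fin k ↪ Fin m) (y : Fin m → Fin n) : (Fin k → Fin n) → F :=
  fun z => x (fun j => if h : ∃ l, e l = j then z h.choose else y j)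

/-- Expected distance under the axis-parallel `k`-flat test `T_m^k` for `C^{⊗m}`. -/
def flatTestE {F : Type*} [Field F] {n : ℕ} (C : Set (Fin n → F)) (m k : ℕ)
    (x : (Fin m → Fin n) → F) : ℝ :=
  (∑ e : Fin k ↪ Fin m, ∑ y : Fin m → Fin n,
      distTo (flatRestrict x e y) (tensorPow C k)) /
    ((Fintype.card (Fin k ↪ Fin m) : ℝ) * (Fintype.card (Fin m → Fin n) : ℝ))

/-- Robustness constant `ρ_r(T_m^k, C^{⊗m})`. -/
def flatRobustConst {F : Type*} [Field F] {n : ℕ} (C : Set (Fin n → F)) (m k : ℕ) : ℝ :=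
  sSup {α : ℝ | ∀ x : (Fin m → Fin n) → F,
    α * distTo x (tensorPow C m) ≤ flatTestE C m k x}

/-- The polynomial `Σ aᵢ xⁱ` of a word of length `n`. -/
def wordPoly {F : Type*} [CommSemiring F] {n : ℕ} (a : Fin n → F) : Polynomial F :=
  ∑ i, Polynomial.C (a i) * Polynomial.X ^ (i : ℕ)

/-- The cyclic code of length `n` with check polynomial `p`. -/
def cyclicCode {F : Type*} [CommRing F] (n : ℕ) (p : Polynomial F) : Set (Fin n → F) :=
  {a | (Polynomial.X ^ n - 1) ∣ p * wordPoly a}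

/-- Check polynomial `(x-1)(x-ω)⋯(x-ω^{k-1})` of the primitive Reed–Solomon code. -/
def rsCheck {F : Type*} [CommRing F] (k : ℕ) (ω : F) : Polynomial F :=
  ∏ i ∈ Finset.range k, (Polynomial.X - Polynomial.C (ω ^ i))

/-- The primitive Reed–Solomon evaluation code of degree `< k` at the nonzero points. -/
def evalRS (F : Type*) [Field F] [Fintype F] (k : ℕ) : Set (Fˣ → F) :=
  {c | ∃ p : Polynomial F, p.degree < (k : ℕ) ∧ ∀ a : Fˣ, c a = p.eval (a : F)}

/-- Words on `ι₁ × ι₂` all of whose columns lie in `S`. -/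
def colCode {ι₁ ι₂ F : Type*} (S : Set (ι₁ → F)) : Set (ι₁ × ι₂ → F) :=
  {x | ∀ j, (fun i => x (i, j)) ∈ S}

/-- Words on `ι₁ × ι₂` all of whose rows lie in `S`. -/
def rowCode {ι₁ ι₂ F : Type*} (S : Set (ι₂ → F)) : Set (ι₁ × ι₂ → F) :=
  {x | ∀ i, (fun j => x (i, j)) ∈ S}

/-- The multivariate polynomial `Σ_y x_y ∏ᵢ Xᵢ^{yᵢ}` of a word on the grid `[n]^m`. -/
def wordPolyMv {F : Type*} [CommSemiring F] {m n : ℕ} (x : (Fin m → Fin n) → F) :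
    MvPolynomial (Fin m) F :=
  ∑ y : Fin m → Fin n, MvPolynomial.C (x y) * ∏ i, MvPolynomial.X i ^ ((y i : ℕ))

/-- Apply the Kronecker product of a family of matrices to a word (from the left). -/
def kronL {F : Type*} [CommRing F] {m n : ℕ} (M : Fin m → Matrix (Fin n) (Fin n) F)
    (w : (Fin m → Fin n) → F) : (Fin m → Fin n) → F :=
  fun y => ∑ z, w z * ∏ i, M i (z i) (y i)

theorem kronL_mul {F : Type*} [CommRing F] {m n : ℕ} (M N : Fin m → Matrix (Fin n) (Fin n) F)
    (w : (Fin m → Fin n) → F) : kronL N (kronL M w) = kronL (fun i => M i * N i) w := by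
  funext y
  simp only [kronL, Matrix.mul_apply, Finset.prod_univ_sum, Fintype.piFinset_univ,
    Finset.mul_sum, Finset.sum_mul, Finset.prod_mul_distrib]
  rw [Finset.sum_comm]
  simp only [mul_assoc]

theorem kronL_one {F : Type*} [CommRing F] {m n : ℕ}
    (w : (Fin m → Fin n) → F) : kronL (fun _ => 1) w = w := by
  funext y
  simp only [kronL]
  rw [Finset.sum_eq_single y]
  · simp
  · intro z _ hz
    obtain ⟨i, hi⟩ := Function.ne_iff.1 hz
    rw [Finset.prod_eq_zero (Finset.mem_univ i), mul_zero]
    exact Matrix.one_apply_ne hi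
  · simp

theorem kronL_single {F : Type*} [CommRing F] {m n : ℕ} (j : Fin m)
    (E : Matrix (Fin n) (Fin n) F) (w : (Fin m → Fin n) → F) (y : Fin m → Fin n) :
    kronL (Function.update (fun _ => 1) j E) w y =
      ∑ t, w (Function.update y j t) * E t (y j) := by
  simp only [kronL]
  symm
  apply Fintype.sum_of_injective (fun t => Function.update y j t) (Function.update_injective y j)
  · intro z hz
    have : ∃ i, i ≠ j ∧ z i ≠ y i := by
      by_contra! h
      apply hz
      refine ⟨z j, ?_⟩
      funext i
      by_cases hi : i = j
      · subst hi; simp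
      · simp [hi, h i hi]
    obtain ⟨i, hij, hi⟩ := this
    rw [Finset.prod_eq_zero (Finset.mem_univ i), mul_zero]
    rw [Function.update_of_ne hij]
    exact Matrix.one_apply_ne hi
  · intro t
    congr 1
    rw [Finset.prod_eq_single j]
    · simp
    · intro i _ hij
      simp [Function.update_of_ne hij]
    · simp

theorem kronL_fix {F : Type*} [CommRing F] {m n : ℕ} (E : Fin m → Matrix (Fin n) (Fin n) F)
    (w : (Fin m → Fin n) → F)
    (h : ∀ j y, w y = ∑ t, w (Function.update y j t) * E j t (y j)) : kronL E w = w := by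
  have key : ∀ S : Finset (Fin m), kronL (fun i => if i ∈ S then E i else 1) w = w := by
    intro S
    induction S using Finset.induction_on with
    | empty => simpa using kronL_one w
    | insert j S hj ih =>
      have h1 : kronL (Function.update (fun _ => 1) j (E j)) w = w := by
        funext y
        rw [kronL_single, ← h]
      have h2 : (fun i => if i ∈ insert j S then E i else 1) =
          fun i => (if i ∈ S then E i else 1) *
            (Function.update (fun _ => (1 : Matrix (Fin n) (Fin n) F)) j (E j)) i := by
        funext i
        by_cases hi : i = j
        · subst hi; simp [hj]
        · simp [hi]
      rw [h2, ← kronL_mul, ih, h1]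
  simpa using key Finset.univ

theorem exists_ginv {F : Type*} [Field F] {n : ℕ} (A : Matrix (Fin n) (Fin n) F) :
    ∃ B : Matrix (Fin n) (Fin n) F, A * B * A = A := by
  set f := Matrix.toLin' A with hf
  obtain ⟨s, hs⟩ := f.rangeRestrict.exists_rightInverse_of_surjective f.range_rangeRestrict
  obtain ⟨g, hg⟩ := LinearMap.exists_extend s
  refine ⟨LinearMap.toMatrix' g, ?_⟩
  apply Matrix.toLin'.injective
  rw [Matrix.toLin'_mul, Matrix.toLin'_mul, Matrix.toLin'_toMatrix', ← hf]
  ext1 v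
  have h1 : g (f v) = s (f.rangeRestrict v) := by
    rw [← hg]; rfl
  have h2 := congrArg Subtype.val (LinearMap.congr_fun hs (f.rangeRestrict v))
  apply LinearMap.ext
  intro a
  have h1 : g (f (LinearMap.single F (fun _ => F) v a)) =
      s (f.rangeRestrict (LinearMap.single F (fun _ => F) v a)) := by
    rw [← hg]; rfl
  have h2 := congrArg Subtype.val
    (LinearMap.congr_fun hs (f.rangeRestrict (LinearMap.single F (fun _ => F) v a)))
  simp only [LinearMap.comp_apply] at h2 ⊢
  rw [h1]
  exact h2

theorem box_ker {F : Type*} [Field F] {m n : ℕ} (A : Fin m → Matrix (Fin n) (Fin n) F) :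
    boxCode (n := fun _ : Fin m => n) (fun i => {a : Fin n → F | (A i).mulVec a = 0}) =
      {x : (Fin m → Fin n) → F | ∀ z : Fin m → Fin n, ∑ y, x y * ∏ i, A i (z i) (y i) = 0} := by
  ext x
  constructor
  · intro hx z
    apply hx (fun y => ∏ i, A i (z i) (y i))
    simp only [prodCode, Set.mem_iInter]
    intro i y c hc
    have hc' : ∑ s, A i (z i) s * c s = 0 := congrFun hc (z i)
    have : ∀ s : Fin n, lineRestrict (n := fun _ : Fin m => n)
        (fun y => ∏ i, A i (z i) (y i)) i y s =
        A i (z i) s * ∏ k ∈ Finset.univ.erase i, A k (z k) (y k) := by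
      intro s
      simp only [lineRestrict]
      rw [← Finset.mul_prod_erase _ _ (Finset.mem_univ i)]
      simp only [Function.update_self]
      congr 1
      apply Finset.prod_congr rfl
      intro k hk
      rw [Function.update_of_ne (Finset.ne_of_mem_erase hk)]
    simp only [this]
    calc _ = (∑ s, A i (z i) s * c s) * ∏ k ∈ Finset.univ.erase i, A k (z k) (y k) := by
          rw [Finset.sum_mul]
          apply Finset.sum_congr rfl
          intro s _
          ring
      _ = 0 := by rw [hc', zero_mul]
  · intro hx w hw
    choose B hB using fun i => exists_ginv (A i)
    simp only [prodCode, Set.mem_iInter] at hw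
    have hfix : kronL (fun i => B i * A i) w = w := by
      apply kronL_fix
      intro j y
      have h1 := hw j y (fun s => (1 - B j * A j) s (y j)) (by
        have : A j * (1 - B j * A j) = 0 := by
          rw [mul_sub, mul_one, ← mul_assoc, hB, sub_self]
        funext s
        exact congrFun (congrFun this s) (y j))
      simp only [lineRestrict, Matrix.sub_apply, mul_sub, Finset.sum_sub_distrib] at h1
      rw [sub_eq_zero] at h1
      rw [← h1]
      simp [Matrix.one_apply]
    rw [← hfix, ← kronL_mul]
    generalize kronL B w = u
    simp only [kronL, Finset.mul_sum]
    rw [Finset.sum_comm]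
    apply Finset.sum_eq_zero
    intro z _
    calc _ = u z * ∑ y, x y * ∏ i, A i (z i) (y i) := by
          rw [Finset.mul_sum]
          apply Finset.sum_congr rfl
          intro s _
          ring
      _ = 0 := by rw [hx z, mul_zero]

theorem exists_mulMatrix {F : Type*} [Field F] (n : ℕ) (p : Polynomial F) :
    ∃ A : Matrix (Fin n) (Fin n) F, ∀ s : Fin n, (Polynomial.X ^ n - 1 : Polynomial F) ∣
      p * Polynomial.X ^ (s : ℕ) - wordPoly (fun t => A t s) := by
  refine ⟨fun t s => ((p * Polynomial.X ^ (s : ℕ)) %ₘ (Polynomial.X ^ n - 1)).coeff t, ?_⟩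
  intro s
  have hn : n ≠ 0 := by
    rintro rfl
    exact s.elim0
  have hmon : (Polynomial.X ^ n - 1 : Polynomial F).Monic := by
    simpa using Polynomial.monic_X_pow_sub_C (1 : F) hn
  have hdeg : (Polynomial.X ^ n - 1 : Polynomial F).natDegree = n := by
    simpa using Polynomial.natDegree_X_pow_sub_C (n := n) (r := (1 : F))
  set r := (p * Polynomial.X ^ (s : ℕ)) %ₘ (Polynomial.X ^ n - 1) with hr
  have h1 : wordPoly (fun t : Fin n => r.coeff t) = r := by
    have hlt : r.natDegree < n := by
      have := Polynomial.natDegree_modByMonic_lt (p * Polynomial.X ^ (s : ℕ)) hmon (by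
        intro h
        rw [h] at hdeg
        simp at hdeg
        exact hn hdeg.symm)
      rwa [hdeg] at this
    conv_rhs => rw [r.as_sum_range_C_mul_X_pow' hlt]
    rw [wordPoly, Finset.sum_range]
  rw [h1]
  refine ⟨(p * Polynomial.X ^ (s : ℕ)) /ₘ (Polynomial.X ^ n - 1), ?_⟩
  rw [sub_eq_iff_eq_add']
  exact (Polynomial.modByMonic_add_div _ _).symm

theorem dvd_wordPoly {F : Type*} [Field F] {n : ℕ} (b : Fin n → F) :
    (Polynomial.X ^ n - 1 : Polynomial F) ∣ wordPoly b ↔ b = 0 := by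
  constructor
  · intro h
    rcases Nat.eq_zero_or_pos n with rfl | hn
    · exact Subsingleton.elim _ _
    have h0 : wordPoly b = 0 := by
      apply Polynomial.eq_zero_of_dvd_of_degree_lt h
      have : (Polynomial.X ^ n - 1 : Polynomial F).degree = n := by
        simpa using Polynomial.degree_X_pow_sub_C hn (1 : F)
      rw [this]
      exact Polynomial.degree_sum_fin_lt b
    funext s
    have := congrArg (fun q => Polynomial.coeff q s) h0
    simpa [wordPoly, Polynomial.finset_sum_coeff, Polynomial.coeff_X_pow, Fin.val_inj] using this
  · rintro rfl
    simp [wordPoly]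

theorem cyclicCode_eq {F : Type*} [Field F] {n : ℕ} {p : Polynomial F}
    {A : Matrix (Fin n) (Fin n) F} (hA : ∀ s : Fin n, (Polynomial.X ^ n - 1 : Polynomial F) ∣
      p * Polynomial.X ^ (s : ℕ) - wordPoly (fun t => A t s)) :
    cyclicCode n p = {a | A.mulVec a = 0} := by
  ext a
  have h : (Polynomial.X ^ n - 1 : Polynomial F) ∣ p * wordPoly a - wordPoly (A.mulVec a) := by
    have : p * wordPoly a - wordPoly (A.mulVec a) = ∑ s, Polynomial.C (a s) *
        (p * Polynomial.X ^ (s : ℕ) - wordPoly (fun t => A t s)) := by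
      simp only [mul_sub, Finset.sum_sub_distrib]
      congr 1
      · rw [wordPoly, Finset.mul_sum]
        exact Finset.sum_congr rfl fun _ _ => by ring
      · simp only [wordPoly, Matrix.mulVec, dotProduct, map_sum, Finset.sum_mul, Finset.mul_sum,
          map_mul]
        rw [Finset.sum_comm]
        exact Finset.sum_congr rfl fun _ _ => Finset.sum_congr rfl fun _ _ => by ring
    rw [this]
    exact Finset.dvd_sum fun s _ => (hA s).mul_left _
  simp only [cyclicCode, Set.mem_setOf_eq]
  rw [← dvd_wordPoly, dvd_iff_dvd_of_dvd_sub h]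

theorem wordPolyMv_mem {F : Type*} [Field F] {m n : ℕ} (b : (Fin m → Fin n) → F) :
    wordPolyMv b ∈ Ideal.span (Set.range fun i : Fin m =>
      (MvPolynomial.X i ^ n - 1 : MvPolynomial (Fin m) F)) ↔ b = 0 := by
  constructor
  · intro h
    let φ : MvPolynomial (Fin m) F →ₐ[F] AddMonoidAlgebra F (Fin m → ZMod n) :=
      MvPolynomial.aeval fun i => AddMonoidAlgebra.single (Pi.single i 1) 1
    have hle : Ideal.span (Set.range fun i : Fin m =>
      (MvPolynomial.X i ^ n - 1 : MvPolynomial (Fin m) F)) ≤ RingHom.ker φ := by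
      rw [Ideal.span_le]
      rintro _ ⟨i, rfl⟩
      have h0 : n • (Pi.single i 1 : Fin m → ZMod n) = 0 := by
        rw [← Pi.single_smul]
        simp
      simp only [SetLike.mem_coe, RingHom.mem_ker, map_sub, map_pow, map_one]
      simp only [φ, MvPolynomial.aeval_X, AddMonoidAlgebra.single_pow, h0, one_pow]
      rw [AddMonoidAlgebra.one_def, sub_self]
    have h1 : φ (wordPolyMv b) = 0 := hle h
    have h2 : φ (wordPolyMv b) =
        ∑ y, AddMonoidAlgebra.single (fun i => ((y i : ℕ) : ZMod n)) (b y) := by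
      simp only [wordPolyMv, map_sum, map_mul, map_prod, map_pow]
      apply Finset.sum_congr rfl
      intro y _
      have : ∏ i, φ (MvPolynomial.X i) ^ (y i : ℕ) =
          AddMonoidAlgebra.single (fun i => ((y i : ℕ) : ZMod n)) 1 := by
        simp only [φ, MvPolynomial.aeval_X, AddMonoidAlgebra.single_pow, one_pow]
        have hs : (fun i => ((y i : ℕ) : ZMod n)) =
            ∑ i, (y i : ℕ) • (Pi.single i 1 : Fin m → ZMod n) := by
          funext k
          simp [Finset.sum_apply, Pi.single_apply]
        rw [hs]
        have := map_prod (AddMonoidAlgebra.of F (Fin m → ZMod n))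
          (fun i => Multiplicative.ofAdd ((y i : ℕ) • (Pi.single i 1 : Fin m → ZMod n)))
          Finset.univ
        rw [← ofAdd_sum] at this
        simpa using this.symm
      rw [this]
      have hC : φ (MvPolynomial.C (b y)) = algebraMap F _ (b y) := φ.commutes (b y)
      rw [hC, ← Algebra.smul_def, AddMonoidAlgebra.smul_single, smul_eq_mul, mul_one]
    rw [h2] at h1
    funext z
    have h3 := congrArg (fun f => f.coeff (fun i => ((z i : ℕ) : ZMod n))) h1
    have hinj : ∀ y : Fin m → Fin n,
        (fun i => ((y i : ℕ) : ZMod n)) = (fun i => ((z i : ℕ) : ZMod n)) → y = z := by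
      intro y hy
      funext i
      have := congrFun hy i
      simp only [ZMod.natCast_eq_natCast_iff'] at this
      rw [Nat.mod_eq_of_lt (y i).2, Nat.mod_eq_of_lt (z i).2] at this
      exact Fin.ext this
    simp only [AddMonoidAlgebra.coeff_sum, Finsupp.finset_sum_apply] at h3
    rw [Finset.sum_eq_single z] at h3
    · simpa using h3
    · intro y _ hy
      simp only [AddMonoidAlgebra.coeff_single]
      exact Finsupp.single_eq_of_ne' fun h => hy (hinj y h)
    · simp
  · rintro rfl
    simp [wordPolyMv]

/-- check-polynomial description of `C₁ ⊞ ⋯ ⊞ C_m` for cyclic codes. -/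
theorem stmt_1 {F : Type*} [Field F] {m n : ℕ} (p : Fin m → Polynomial F)
    (hp : ∀ i, p i ∣ (Polynomial.X ^ n - 1)) :
    boxCode (n := fun _ : Fin m => n) (fun i => cyclicCode n (p i)) =
      {x : (Fin m → Fin n) → F |
        wordPolyMv x *
            ∏ i, Polynomial.aeval (MvPolynomial.X i : MvPolynomial (Fin m) F) (p i) ∈
          Ideal.span (Set.range fun i : Fin m => MvPolynomial.X i ^ n - 1)} := by
  choose A hA using fun i => exists_mulMatrix n (p i)
  have h1 : (fun i => cyclicCode n (p i)) = fun i => {a : Fin n → F | (A i).mulVec a = 0} :=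
    funext fun i => cyclicCode_eq (hA i)
  rw [h1, box_ker]
  ext x
  set I := Ideal.span (Set.range fun i : Fin m =>
      (MvPolynomial.X i ^ n - 1 : MvPolynomial (Fin m) F)) with hI
  have hcong : ∀ i (s : Fin n), Ideal.Quotient.mk I
      (MvPolynomial.X i ^ (s : ℕ) * Polynomial.aeval (MvPolynomial.X i) (p i)) =
      Ideal.Quotient.mk I (∑ t : Fin n, MvPolynomial.C (A i t s) * MvPolynomial.X i ^ (t : ℕ)) := by
    intro i s
    rw [Ideal.Quotient.eq]
    obtain ⟨q, hq⟩ := hA i s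
    have h2 := congrArg (Polynomial.aeval (MvPolynomial.X i : MvPolynomial (Fin m) F)) hq
    simp only [wordPoly, map_sub, map_mul, map_pow, map_sum, Polynomial.aeval_X,
      Polynomial.aeval_C, map_one, MvPolynomial.algebraMap_eq] at h2
    rw [mul_comm, h2]
    exact I.mul_mem_right _ (Ideal.subset_span ⟨i, rfl⟩)
  have key : Ideal.Quotient.mk I (wordPolyMv x *
      ∏ i, Polynomial.aeval (MvPolynomial.X i : MvPolynomial (Fin m) F) (p i)) =
      Ideal.Quotient.mk I (wordPolyMv fun z => ∑ y, x y * ∏ i, A i (z i) (y i)) := by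
    have e1 : wordPolyMv x *
        ∏ i, Polynomial.aeval (MvPolynomial.X i : MvPolynomial (Fin m) F) (p i) =
        ∑ y, MvPolynomial.C (x y) * ∏ i, (MvPolynomial.X i ^ (y i : ℕ) *
          Polynomial.aeval (MvPolynomial.X i : MvPolynomial (Fin m) F) (p i)) := by
      rw [wordPolyMv, Finset.sum_mul]
      exact Finset.sum_congr rfl fun y _ => by rw [Finset.prod_mul_distrib, mul_assoc]
    have e2 : (wordPolyMv fun z : Fin m → Fin n => ∑ y, x y * ∏ i, A i (z i) (y i)) =
        ∑ y, MvPolynomial.C (x y) * ∏ i, (∑ t : Fin n,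
          MvPolynomial.C (A i t (y i)) * MvPolynomial.X i ^ (t : ℕ)) := by
      simp only [wordPolyMv, Finset.prod_univ_sum, Fintype.piFinset_univ, Finset.mul_sum,
        Finset.sum_mul, map_sum, map_mul, map_prod, Finset.prod_mul_distrib]
      rw [Finset.sum_comm]
      simp only [mul_assoc]
    rw [e1, e2, map_sum, map_sum]
    refine Finset.sum_congr rfl fun y _ => ?_
    rw [map_mul, map_mul, map_prod, map_prod]
    congr 1
    exact Finset.prod_congr rfl fun i _ => hcong i (y i)
  simp only [Set.mem_setOf_eq]
  rw [← Ideal.Quotient.eq_zero_iff_mem, key, Ideal.Quotient.eq_zero_iff_mem, hI, wordPolyMv_mem,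
    funext_iff]
  rfl

end
end

section
/- Let C be the [n, k] primitive Reed–Solomon code over F_q with n = q − 1, k < n/2. Suppose c₁ ∈ C ⊗ F_q^n and c₂ ∈ F_q^n ⊗ C satisfy δ(c₁, c₂) ≤ (1/2 − k/n)². Then δ(c₁, C ⊗ C) ≤ 2·δ(c₁, c₂) and δ(c₂, C ⊗ C) ≤ 2·δ(c₁, c₂). -/
noncomputable section

open Polynomial

namespace PS
open Polynomial.Bivariate

lemma coeff_swap {F : Type*} [Field F] (p : F[X][Y]) (i j : ℕ) :
    ((Bivariate.swap p).coeff i).coeff j = (p.coeff j).coeff i := by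
  induction p using Polynomial.induction_on' with
  | add p q hp hq => simp [hp, hq]
  | monomial n a =>
    induction a using Polynomial.induction_on' with
    | add p q hp hq => simp only [map_add, coeff_add, hp, hq]
    | monomial m r =>
      rw [Bivariate.swap_monomial_monomial]
      simp only [coeff_monomial]
      by_cases h1 : m = i <;> by_cases h2 : n = j <;> simp [h1, h2, coeff_monomial]

lemma swap_natDegree_le {F : Type*} [Field F] (p : F[X][Y]) (a : ℕ) :
    (Bivariate.swap p).natDegree ≤ a ↔ ∀ i, (p.coeff i).natDegree ≤ a := by
  simp only [natDegree_le_iff_coeff_eq_zero]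
  constructor
  · intro h i j hj
    rw [← coeff_swap, h j hj, coeff_zero]
  · intro h j hj
    ext i
    rw [coeff_swap, h i j hj, coeff_zero]

lemma swap_map_eval {F : Type*} [Field F] (p : F[X][Y]) (x : F) :
    (Bivariate.swap p).map (evalRingHom x) = p.eval (C x) := by
  induction p using Polynomial.induction_on' with
  | add p q hp hq => simp [hp, hq]
  | monomial n a =>
    rw [Bivariate.swap_monomial]
    simp only [Polynomial.map_mul, Polynomial.map_map, map_C, eval_monomial]
    congr 1
    · convert Polynomial.map_id using 2
      ext; simp
    · simp

lemma swap_eval {F : Type*} [Field F] (p : F[X][Y]) (x : F) :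
    (Bivariate.swap p).eval (C x) = p.map (evalRingHom x) := by
  rw [← swap_map_eval, Bivariate.swap_swap_apply]

lemma resultant_natDegree_le {F : Type*} [Field F] (f g : F[X][Y]) (m n af ag : ℕ)
    (hf : ∀ i, (f.coeff i).natDegree ≤ af) (hg : ∀ i, (g.coeff i).natDegree ≤ ag) :
    (resultant f g m n).natDegree ≤ m * ag + n * af := by
  rw [resultant, Matrix.det_apply]
  refine natDegree_sum_le_of_forall_le _ _ fun σ _ => ?_
  refine (natDegree_smul_le _ _).trans ((natDegree_prod_le _ _).trans ?_)
  rw [Fin.sum_univ_add]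
  refine add_le_add ?_ ?_
  · refine (Finset.sum_le_card_nsmul _ _ ag fun i _ => ?_).trans (by simp)
    simp only [sylvester, Matrix.of_apply, Fin.addCases_left]
    split_ifs
    · exact hg _
    · simp
  · refine (Finset.sum_le_card_nsmul _ _ af fun i _ => ?_).trans (by simp)
    simp only [sylvester, Matrix.of_apply, Fin.addCases_right]
    split_ifs
    · exact hf _
    · simp

lemma resultant_ne_zero_of_rel {F : Type*} [Field F] (E P : F[X][Y]) (hE : E ≠ 0)
    (rel : IsRelPrime E P) (n : ℕ) (hP : P.natDegree ≤ n) :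
    resultant E P E.natDegree n ≠ 0 := by
  intro h0
  have hM := toMatrix_sylvesterMap' E P le_rfl hP
  have hdet : (sylvester E P E.natDegree n).det = 0 := h0
  rw [← hM] at hdet
  have : ¬ Function.Injective (sylvesterMap E P le_rfl hP) := by
    intro hinj
    obtain ⟨v, hv, hv0⟩ := Matrix.exists_mulVec_eq_zero_iff.mpr hdet
    set b₁ := (((degreeLT.basis F[X] E.natDegree).prod (degreeLT.basis F[X] n)).reindex finSumFinEquiv)
    set b₂ := degreeLT.basis F[X] (E.natDegree + n)
    have h1 := LinearMap.toMatrix_mulVec_repr b₁ b₂ (sylvesterMap E P le_rfl hP)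
      (b₁.equivFun.symm v)
    have h2 : (⇑(b₁.repr (b₁.equivFun.symm v))) = v := by
      rw [← Module.Basis.equivFun_apply]; exact LinearEquiv.apply_symm_apply _ _
    rw [h2, hv0] at h1
    have h3 : sylvesterMap E P le_rfl hP (b₁.equivFun.symm v) = 0 := by
      apply b₂.repr.injective
      ext i
      rw [← h1]; simp
    rw [← map_zero (sylvesterMap E P le_rfl hP)] at h3
    have h4 := hinj h3
    apply hv
    exact (LinearEquiv.map_eq_zero_iff _).mp h4
  apply this
  rw [injective_iff_map_eq_zero]
  rintro ⟨⟨p, hp⟩, ⟨q, hq⟩⟩ h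
  have h' : E * q + P * p = 0 := congrArg Subtype.val h
  have hd : E ∣ P * p := ⟨-q, by linear_combination h'⟩
  have hd2 : E ∣ p := rel.dvd_of_dvd_mul_left hd
  have hp0 : p = 0 := by
    by_contra hne
    have := Polynomial.degree_le_of_dvd hd2 hne
    rw [mem_degreeLT] at hp
    rw [degree_eq_natDegree hE] at this
    exact absurd hp (not_lt.mpr this)
  subst hp0
  have hq0 : q = 0 := by
    simpa [hE] using h'
  subst hq0
  rfl

lemma core {F ι : Type*} [Field F] [DecidableEq ι] (v : ι → F) (hv : Function.Injective v)
    (E P : F[X][Y]) (hE : E ≠ 0)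
    (rel : IsRelPrime E P) (d : ℕ) (hP : P.natDegree ≤ E.natDegree + d)
    (hP' : (Bivariate.swap P).natDegree ≤ (Bivariate.swap E).natDegree + d)
    (J : Finset ι) (r : ι → F[X]) (hr : ∀ y, (r y).natDegree ≤ d)
    (hJr : ∀ y ∈ J, P.map (evalRingHom (v y)) = r y * E.map (evalRingHom (v y)))
    (hJ : 2 * (Bivariate.swap E).natDegree + 2 * d < J.card)
    (hab : (Bivariate.swap E).natDegree ≤ E.natDegree) : E.natDegree = 0 := by
  by_contra hb
  set a := (Bivariate.swap E).natDegree with ha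
  set b := E.natDegree with hbd
  let R : F[X][Y] := ∑ j ∈ J, C (Lagrange.basis J v j) * (r j).map C
  have hRd : R.natDegree ≤ d := by
    refine natDegree_sum_le_of_forall_le _ _ fun j _ => ?_
    exact (natDegree_C_mul_le _ _).trans (natDegree_map_le.trans (hr j))
  have hRe : ∀ y ∈ J, R.map (evalRingHom (v y)) = r y := by
    intro y hy
    simp only [R, Polynomial.map_sum, Polynomial.map_mul, map_C, Polynomial.map_map, coe_evalRingHom]
    rw [Finset.sum_eq_single y]
    · rw [Lagrange.eval_basis_self hv.injOn hy]
      have : (evalRingHom (v y)).comp C = RingHom.id F := by ext; simp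
      simp [this]
    · intro j hj hne
      rw [Lagrange.eval_basis_of_ne hne hy]; simp
    · exact fun h => absurd hy h
  let Z : F[X] := Lagrange.nodal J v
  have hZ : C Z ∣ P - E * R := by
    rw [C_dvd_iff_dvd_coeff]
    intro i
    rw [show Z = ∏ j ∈ J, (X - C (v j)) from rfl]
    refine Finset.prod_dvd_of_coprime ?_ ?_
    · intro x _ y _ hxy
      exact isCoprime_X_sub_C_of_isUnit_sub (sub_ne_zero.mpr (hv.ne hxy)).isUnit
    · intro y hy
      rw [dvd_iff_isRoot, IsRoot, ← coe_evalRingHom, ← coeff_map, Polynomial.map_sub,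
        Polynomial.map_mul, hRe y hy, hJr y hy]
      simp [mul_comm]
  obtain ⟨W, hW⟩ := hZ
  have hPW : P = C Z * W + E * R := by linear_combination hW
  have hne := resultant_ne_zero_of_rel E P hE rel (b + d) hP
  have hres : resultant E P b (b + d) = Z ^ b * resultant E W b (b + d) := by
    rw [hPW, resultant_add_mul_right _ _ _ _ _ (by omega) le_rfl, resultant_C_mul_right]
  have hdeg := resultant_natDegree_le E P b (b + d) a (a + d)
    ((swap_natDegree_le E a).mp le_rfl) ((swap_natDegree_le P (a + d)).mp hP')
  have hdvd : Z ^ b ∣ resultant E P b (b + d) := ⟨_, hres⟩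
  have h1 := natDegree_le_of_dvd hdvd hne
  rw [natDegree_pow, Lagrange.natDegree_nodal] at h1
  have h2 := h1.trans hdeg
  have h3 : b * (2 * a + 2 * d + 1) ≤ b * J.card := Nat.mul_le_mul_left _ hJ
  have h4 : d * a ≤ d * b := Nat.mul_le_mul_left _ hab
  have h5 : 0 < b := Nat.pos_of_ne_zero hb
  nlinarith


lemma exists_locator {F κ : Type*} [Field F] (T : Finset κ) (px py : κ → F) (e : ℕ)
    (hT : T.card < (e + 1) * (e + 1)) :
    ∃ E : F[X][Y], E ≠ 0 ∧ E.natDegree ≤ e ∧ (Bivariate.swap E).natDegree ≤ e ∧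
      ∀ t ∈ T, (E.eval (C (px t))).eval (py t) = 0 := by
  let L : (Fin (e + 1) × Fin (e + 1) → F) →ₗ[F] (T → F) :=
    { toFun := fun w t => ∑ s, w s * (px t ^ (s.1 : ℕ) * py t ^ (s.2 : ℕ))
      map_add' := by
        intro w w'; ext t; simp [add_mul, Finset.sum_add_distrib]
      map_smul' := by
        intro c w; ext t; simp [mul_assoc, Finset.mul_sum] }
  have hker : LinearMap.ker L ≠ ⊥ := by
    apply LinearMap.ker_ne_bot_of_finrank_lt
    simpa using hT
  obtain ⟨w, hw, hw0⟩ := (Submodule.ne_bot_iff _).mp hker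
  let E : F[X][Y] := ∑ s, monomial (s.1 : ℕ) (monomial (s.2 : ℕ) (w s))
  have hco : ∀ s : Fin (e + 1) × Fin (e + 1), (E.coeff s.1).coeff s.2 = w s := by
    intro s
    simp only [E, finsetSum_coeff, coeff_monomial]
    rw [Finset.sum_eq_single s]
    · simp
    · intro s' _ hne
      by_cases h1 : (s'.1 : ℕ) = s.1
      · by_cases h2 : (s'.2 : ℕ) = s.2
        · exact absurd (Prod.ext (Fin.ext h1) (Fin.ext h2)) hne
        · simp [h1, coeff_monomial, h2]
      · simp [h1]
    · simp
  refine ⟨E, ?_, ?_, ?_, ?_⟩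
  · intro h
    apply hw0
    ext s
    rw [← hco s, h]; simp
  · refine natDegree_sum_le_of_forall_le _ _ fun s _ => ?_
    exact (natDegree_monomial_le _).trans (Nat.lt_succ_iff.mp s.1.2)
  · simp only [E, map_sum, Bivariate.swap_monomial_monomial]
    refine natDegree_sum_le_of_forall_le _ _ fun s _ => ?_
    exact (natDegree_monomial_le _).trans (Nat.lt_succ_iff.mp s.2.2)
  · intro t ht
    have := congrFun (LinearMap.mem_ker.mp hw) ⟨t, ht⟩
    simp only [L, LinearMap.coe_mk, AddHom.coe_mk, Pi.zero_apply] at this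
    rw [← this]
    simp only [E, eval_finsetSum, eval_monomial, eval_mul, eval_pow, eval_C]
    exact Finset.sum_congr rfl fun s _ => by ring

lemma eval_eval_comm {F : Type*} [Field F] (p : F[X][Y]) (x y : F) :
    (p.map (evalRingHom y)).eval x = (p.eval (C x)).eval y := by
  have := Polynomial.hom_eval₂ p (RingHom.id _) (evalRingHom y) (C x)
  rw [eval₂_id] at this
  rw [eval_map]
  simpa using this.symm

lemma natDegree_eval_C_le {F : Type*} [Field F] (p : F[X][Y]) (x : F) :
    (p.eval (C x)).natDegree ≤ (Bivariate.swap p).natDegree := by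
  rw [← swap_map_eval]; exact natDegree_map_le

lemma poly_eq {F ι : Type*} [Field F] (v : ι → F) (hv : Function.Injective v) (s : Finset ι)
    (p q : F[X]) (m : ℕ) (hp : p.natDegree ≤ m) (hq : q.natDegree ≤ m) (hm : m < s.card)
    (h : ∀ i ∈ s, p.eval (v i) = q.eval (v i)) : p = q := by
  apply Polynomial.eq_of_degrees_lt_of_eval_index_eq s (v := v) hv.injOn
  · exact lt_of_le_of_lt degree_le_natDegree (by exact_mod_cast lt_of_le_of_lt hp hm)
  · exact lt_of_le_of_lt degree_le_natDegree (by exact_mod_cast lt_of_le_of_lt hq hm)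
  · exact h

/-- Number of indices at which a nonzero bivariate polynomial specializes to zero. -/
lemma card_map_eq_zero {F ι : Type*} [Field F] [DecidableEq F] [Fintype ι] (v : ι → F)
    (hv : Function.Injective v) (G : F[X][Y]) (hG : G ≠ 0) :
    (Finset.univ.filter fun y => G.map (evalRingHom (v y)) = 0).card ≤
      (Bivariate.swap G).natDegree := by
  classical
  by_contra hlt
  push Not at hlt
  apply hG
  ext1 i
  rw [coeff_zero]
  refine poly_eq v hv _ _ _ _ ((swap_natDegree_le G _).mp le_rfl i) (by simp) hlt ?_
  intro y hy
  rw [Finset.mem_filter] at hy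
  rw [← coe_evalRingHom, ← coeff_map, hy.2]
  simp

lemma exists_P {F ι : Type*} [Field F] [DecidableEq ι] [Fintype ι] (v : ι → F)
    (hv : Function.Injective v) (d : ℕ) (r c : ι → F[X])
    (hr : ∀ y, (r y).natDegree ≤ d) (hc : ∀ x, (c x).natDegree ≤ d)
    (E : F[X][Y])
    (h1 : E.natDegree + d < Fintype.card ι) (h2 : (Bivariate.swap E).natDegree + d < Fintype.card ι)
    (hE : ∀ x y, (r y).eval (v x) * (E.eval (C (v x))).eval (v y) =
      (c x).eval (v y) * (E.eval (C (v x))).eval (v y)) :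
    ∃ P : F[X][Y], P.natDegree ≤ E.natDegree + d ∧
      (Bivariate.swap P).natDegree ≤ (Bivariate.swap E).natDegree + d ∧
      (∀ y, P.map (evalRingHom (v y)) = r y * E.map (evalRingHom (v y))) ∧
      (∀ x, P.eval (C (v x)) = c x * E.eval (C (v x))) := by
  obtain ⟨s, -, hs⟩ := Finset.exists_subset_card_eq
    (s := (Finset.univ : Finset ι)) (n := E.natDegree + d + 1) (by rw [Finset.card_univ]; omega)
  let P : F[X][Y] := ∑ i ∈ s, (Lagrange.basis s v i).map C * C (c i * E.eval (C (v i)))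
  have hdc : ∀ i, (c i * E.eval (C (v i))).natDegree ≤ (Bivariate.swap E).natDegree + d := by
    intro i
    refine natDegree_mul_le.trans ?_
    have := natDegree_eval_C_le E (v i)
    have := hc i
    omega
  have hdr : ∀ y, (r y * E.map (evalRingHom (v y))).natDegree ≤ E.natDegree + d := by
    intro y
    refine natDegree_mul_le.trans ?_
    have : (E.map (evalRingHom (v y))).natDegree ≤ E.natDegree := natDegree_map_le
    have := hr y
    omega
  have hPd : P.natDegree ≤ E.natDegree + d := by
    refine natDegree_sum_le_of_forall_le _ _ fun i hi => ?_
    refine (natDegree_mul_C_le _ _).trans (natDegree_map_le.trans ?_)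
    rw [Lagrange.natDegree_basis hv.injOn hi]; omega
  have hPs : (Bivariate.swap P).natDegree ≤ (Bivariate.swap E).natDegree + d := by
    simp only [P, map_sum, map_mul, Bivariate.swap_map_C, Bivariate.swap_C]
    refine natDegree_sum_le_of_forall_le _ _ fun i hi => ?_
    rw [← Polynomial.map_mul]
    exact (natDegree_C_mul_le _ _).trans (natDegree_map_le.trans (hdc i))
  have hrow : ∀ y, P.map (evalRingHom (v y)) = r y * E.map (evalRingHom (v y)) := by
    intro y
    refine poly_eq v hv s _ _ _ (natDegree_map_le.trans hPd) (hdr y) (by omega) ?_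
    intro x hx
    have hid : (evalRingHom (v y)).comp C = RingHom.id F := by ext; simp
    rw [eval_mul, eval_eval_comm E, hE x y]
    simp only [P, Polynomial.map_sum, Polynomial.map_mul, map_C, Polynomial.map_map, hid,
      Polynomial.map_id, eval_finsetSum, eval_mul, eval_C, coe_evalRingHom]
    rw [Finset.sum_eq_single x]
    · rw [Lagrange.eval_basis_self hv.injOn hx]; simp
    · intro j hj hne
      rw [Lagrange.eval_basis_of_ne hne hx]; simp
    · exact fun h => absurd hx h
  refine ⟨P, hPd, hPs, hrow, ?_⟩
  intro x
  refine poly_eq v hv Finset.univ _ _ _ ((natDegree_eval_C_le _ _).trans hPs) (hdc x)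
    (by rwa [Finset.card_univ]) ?_
  intro y _
  rw [← eval_eval_comm, hrow y, eval_mul, eval_mul, eval_eval_comm, hE]

theorem ps {F ι : Type*} [Field F] [DecidableEq F] [DecidableEq ι] [Fintype ι] (v : ι → F)
    (hv : Function.Injective v) (d e : ℕ) (r c : ι → F[X])
    (hr : ∀ y, (r y).natDegree ≤ d) (hc : ∀ x, (c x).natDegree ≤ d)
    (hn : 2 * e + 2 * d < Fintype.card ι)
    (hN : (Finset.univ.filter fun p : ι × ι => (r p.2).eval (v p.1) ≠ (c p.1).eval (v p.2)).card
      < (e + 1) * (e + 1)) :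
    ∃ Q : F[X][Y], Q.natDegree ≤ d ∧ (Bivariate.swap Q).natDegree ≤ d ∧
      (Finset.univ.filter fun y => Q.map (evalRingHom (v y)) ≠ r y).card ≤ e ∧
      (Finset.univ.filter fun x => Q.eval (C (v x)) ≠ c x).card ≤ e := by
  obtain ⟨E, hE0, hEe, hEs, hEv⟩ := exists_locator _ (fun p : ι × ι => v p.1) (fun p => v p.2) e hN
  have hE : ∀ x y, (r y).eval (v x) * (E.eval (C (v x))).eval (v y) =
      (c x).eval (v y) * (E.eval (C (v x))).eval (v y) := by
    intro x y
    by_cases h : (r y).eval (v x) = (c x).eval (v y)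
    · rw [h]
    · rw [hEv (x, y) (by simpa using h)]; simp
  obtain ⟨P, hP, hPs, hrow, hcol⟩ := exists_P v hv d r c hr hc E (by omega) (by omega) hE
  obtain ⟨E', P', G, hrel, hEG, hPG⟩ := UniqueFactorizationMonoid.exists_reduced_factors E hE0 P
  have hG0 : G ≠ 0 := by rintro rfl; simp at hEG; exact hE0 hEG.symm
  have hE'0 : E' ≠ 0 := by rintro rfl; simp at hEG; exact hE0 hEG.symm
  have hsG0 : Bivariate.swap G ≠ 0 := by simpa using hG0
  have hsE'0 : Bivariate.swap E' ≠ 0 := by simpa using hE'0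
  have hdE : E.natDegree = G.natDegree + E'.natDegree := by
    rw [← hEG, natDegree_mul hG0 hE'0]
  have hdsE : (Bivariate.swap E).natDegree =
      (Bivariate.swap G).natDegree + (Bivariate.swap E').natDegree := by
    rw [← hEG, map_mul, natDegree_mul hsG0 hsE'0]
  have hdP : P'.natDegree ≤ E'.natDegree + d := by
    by_cases h : P' = 0
    · simp [h]
    · rw [← hPG, natDegree_mul hG0 h] at hP; omega
  have hdsP : (Bivariate.swap P').natDegree ≤ (Bivariate.swap E').natDegree + d := by
    by_cases h : P' = 0
    · simp [h]
    · rw [← hPG, map_mul, natDegree_mul hsG0 (by simpa using h)] at hPs; omega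
  have hJc := card_map_eq_zero v hv G hG0
  have hIc := card_map_eq_zero v hv (Bivariate.swap G) hsG0
  rw [Bivariate.swap_swap_apply] at hIc
  simp only [swap_map_eval] at hIc
  have hJr : ∀ y, G.map (evalRingHom (v y)) ≠ 0 →
      P'.map (evalRingHom (v y)) = r y * E'.map (evalRingHom (v y)) := by
    intro y hy
    have := hrow y
    rw [← hPG, ← hEG, Polynomial.map_mul, Polynomial.map_mul] at this
    apply mul_left_cancel₀ hy
    rw [this]; ring
  have hIr : ∀ x, G.eval (C (v x)) ≠ 0 → P'.eval (C (v x)) = c x * E'.eval (C (v x)) := by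
    intro y hy
    have := hcol y
    rw [← hPG, ← hEG, eval_mul, eval_mul] at this
    apply mul_left_cancel₀ hy
    rw [this]; ring
  have hJcard := Finset.card_filter_add_card_filter_not (s := (Finset.univ : Finset ι))
    (fun y => G.map (evalRingHom (v y)) = 0)
  have hIcard := Finset.card_filter_add_card_filter_not (s := (Finset.univ : Finset ι))
    (fun x => G.eval (C (v x)) = 0)
  rw [Finset.card_univ] at hJcard hIcard
  have hrel' : IsRelPrime E' P' := hrel
  have c1 : (Bivariate.swap E').natDegree ≤ E'.natDegree → E'.natDegree = 0 := by
    refine core v hv E' P' hE'0 hrel' d hdP hdsP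
      (Finset.univ.filter fun y => ¬ G.map (evalRingHom (v y)) = 0) r hr ?_ ?_
    · intro y hy
      exact hJr y (Finset.mem_filter.mp hy).2
    · omega
  have hrels : IsRelPrime (Bivariate.swap E') (Bivariate.swap P') := by
    intro t h1 h2
    have h1' := map_dvd Bivariate.swap h1
    have h2' := map_dvd Bivariate.swap h2
    rw [Bivariate.swap_swap_apply] at h1' h2'
    have := (hrel' h1' h2').map Bivariate.swap
    rwa [Bivariate.swap_swap_apply] at this
  have c2 : E'.natDegree ≤ (Bivariate.swap E').natDegree → (Bivariate.swap E').natDegree = 0 := by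
    have := core v hv (Bivariate.swap E') (Bivariate.swap P') hsE'0 hrels d hdsP
      (by simpa only [Bivariate.swap_swap_apply] using hdP)
      (Finset.univ.filter fun x => ¬ G.eval (C (v x)) = 0) c hc
    simp only [Bivariate.swap_swap_apply, swap_map_eval] at this
    refine this ?_ ?_
    · intro y hy
      exact hIr y (Finset.mem_filter.mp hy).2
    · omega
  have z1 : E'.natDegree = 0 := by omega
  have z2 : (Bivariate.swap E').natDegree = 0 := by omega
  obtain ⟨f, hf⟩ := natDegree_eq_zero.mp z1
  have hf0 : f.natDegree = 0 := by
    have := (swap_natDegree_le E' 0).mp z2.le 0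
    rw [← hf, coeff_C_zero] at this; omega
  obtain ⟨u, rfl⟩ := natDegree_eq_zero.mp hf0
  have hu : u ≠ 0 := by rintro rfl; simp at hf; exact hE'0 hf.symm
  subst hf
  refine ⟨C (C u⁻¹) * P', ?_, ?_, ?_, ?_⟩
  · exact (natDegree_C_mul_le _ _).trans (by omega)
  · rw [map_mul, Bivariate.swap_C_C]
    exact (natDegree_C_mul_le _ _).trans (by omega)
  · refine le_trans (Finset.card_le_card ?_) (hJc.trans (by omega))
    intro y
    simp only [Finset.mem_filter, Finset.mem_univ, true_and]
    intro h
    by_contra h'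
    apply h
    rw [Polynomial.map_mul, hJr y h']
    simp only [map_C, coe_evalRingHom, eval_C]
    rw [mul_left_comm, ← C_mul, inv_mul_cancel₀ hu]; simp
  · refine le_trans (Finset.card_le_card ?_) (hIc.trans (by omega))
    intro y
    simp only [Finset.mem_filter, Finset.mem_univ, true_and]
    intro h
    by_contra h'
    apply h
    rw [eval_mul, hIr y h']
    simp only [eval_C]
    rw [mul_left_comm, ← C_mul, inv_mul_cancel₀ hu]; simp

lemma counting {F ι : Type*} [DecidableEq F] [Fintype ι] (rf cf qf : ι → ι → F) (d e : ℕ)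
    (hn : 2 * e + 2 * d ≤ Fintype.card ι) [DecidablePred fun x => ∃ y, qf x y ≠ cf x y]
    (hI : (Finset.univ.filter fun x => ∃ y, qf x y ≠ cf x y).card ≤ e)
    (hr : ∀ y, (∀ x, rf x y = qf x y) ∨
      (Finset.univ.filter fun x => rf x y = qf x y).card ≤ d) :
    (Finset.univ.filter fun p : ι × ι => rf p.1 p.2 ≠ qf p.1 p.2).card ≤
      2 * (Finset.univ.filter fun p : ι × ι => rf p.1 p.2 ≠ cf p.1 p.2).card := by
  classical
  have key : ∀ g : ι → ι → F, (Finset.univ.filter fun p : ι × ι => rf p.1 p.2 ≠ g p.1 p.2).card =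
      ∑ y, (Finset.univ.filter fun x => rf x y ≠ g x y).card := by
    intro g
    simp only [Finset.card_filter]
    rw [Fintype.sum_prod_type_right]
  rw [key, key, Finset.mul_sum]
  refine Finset.sum_le_sum fun y _ => ?_
  rcases hr y with h | h
  · simp [h]
  · have h1 : (Finset.univ.filter fun x => rf x y ≠ qf x y).card ≤ Fintype.card ι :=
      Finset.card_le_univ _
    have h2 : (Finset.univ : Finset ι) ⊆ (Finset.univ.filter fun x => ∃ y, qf x y ≠ cf x y) ∪
        (Finset.univ.filter fun x => rf x y = qf x y) ∪
        (Finset.univ.filter fun x => rf x y ≠ cf x y) := by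
      intro x _
      simp only [Finset.mem_union, Finset.mem_filter, Finset.mem_univ, true_and]
      by_cases h3 : rf x y = cf x y
      · by_cases h4 : rf x y = qf x y
        · exact Or.inl (Or.inr h4)
        · exact Or.inl (Or.inl ⟨y, fun h5 => h4 (h3.trans h5.symm)⟩)
      · exact Or.inr h3
    have h3 := Finset.card_le_card h2
    have h4 := Finset.card_union_le ((Finset.univ.filter fun x => ∃ y, qf x y ≠ cf x y) ∪
        (Finset.univ.filter fun x => rf x y = qf x y)) (Finset.univ.filter fun x => rf x y ≠ cf x y)
    have h5 := Finset.card_union_le (Finset.univ.filter fun x => ∃ y, qf x y ≠ cf x y)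
        (Finset.univ.filter fun x => rf x y = qf x y)
    rw [Finset.card_univ] at h3
    omega

end PS

lemma normWt_eq {ι F : Type*} [Fintype ι] [Zero F] [DecidableEq F] (x : ι → F) :
    normWt x = ((Finset.univ.filter fun p => x p ≠ 0).card : ℝ) / (Fintype.card ι : ℝ) := by
  rw [normWt, Nat.card_eq_fintype_card, Fintype.card_subtype]

lemma distTo_le {ι F : Type*} [Fintype ι] [AddGroup F] (x c : ι → F) (S : Set (ι → F))
    (hc : c ∈ S) : distTo x S ≤ normWt (x - c) := by
  refine csInf_le ⟨0, ?_⟩ ⟨c, hc, rfl⟩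
  rintro _ ⟨y, -, rfl⟩
  simp only [normWt]
  positivity

lemma natDegree_le_of_degree_lt {F : Type*} [Field F] {p : Polynomial F} {k : ℕ}
    (h : p.degree < (k : ℕ)) : p.natDegree ≤ k - 1 := by
  by_cases hp : p = 0
  · simp [hp]
  · have := (natDegree_lt_iff_degree_lt hp).mpr h
    omega

lemma degree_lt_of_natDegree_le {F : Type*} [Field F] {p : Polynomial F} {k : ℕ} (hk : 0 < k)
    (h : p.natDegree ≤ k - 1) : p.degree < (k : ℕ) := by
  refine lt_of_le_of_lt degree_le_natDegree ?_
  exact_mod_cast (by omega : p.natDegree < k)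

lemma eq_or_card_le {F : Type*} [Field F] [Fintype F] [DecidableEq F] (p q : Polynomial F) (d : ℕ)
    (hp : p.natDegree ≤ d) (hq : q.natDegree ≤ d) :
    (∀ x : Fˣ, p.eval (x : F) = q.eval (x : F)) ∨
      (Finset.univ.filter fun x : Fˣ => p.eval (x : F) = q.eval (x : F)).card ≤ d := by
  by_cases h : (Finset.univ.filter fun x : Fˣ => p.eval (x : F) = q.eval (x : F)).card ≤ d
  · exact Or.inr h
  · left
    push Not at h
    have := PS.poly_eq (fun x : Fˣ => (x : F)) Units.val_injective _ p q d hp hq h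
      (fun i hi => (Finset.mem_filter.mp hi).2)
    intro x
    rw [this]

/-- Polishchuk–Spielman corollary for Reed–Solomon codes: if
`δ(c₁,c₂) ≤ (1/2 − k/n)²` then both `c₁` and `c₂` are `2δ(c₁,c₂)`-close to `C ⊗ C`. -/
theorem stmt_13 {F : Type*} [Field F] [Fintype F] [DecidableEq F] (k : ℕ)
    (hk : 2 * k < Fintype.card Fˣ) (c₁ c₂ : Fˣ × Fˣ → F)
    (hc₁ : c₁ ∈ (colCode (evalRS F k) : Set (Fˣ × Fˣ → F)))
    (hc₂ : c₂ ∈ (rowCode (evalRS F k) : Set (Fˣ × Fˣ → F)))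
    (hδ : normWt (c₁ - c₂) ≤ (1 / 2 - (k : ℝ) / (Fintype.card Fˣ : ℝ)) ^ 2) :
    distTo c₁ ((colCode (evalRS F k) : Set (Fˣ × Fˣ → F)) ∩ rowCode (evalRS F k)) ≤
        2 * normWt (c₁ - c₂) ∧
      distTo c₂ ((colCode (evalRS F k) : Set (Fˣ × Fˣ → F)) ∩ rowCode (evalRS F k)) ≤
        2 * normWt (c₁ - c₂) := by
  rcases Nat.eq_zero_or_pos k with rfl | hk0
  · have hz : ∀ w ∈ evalRS F 0, w = 0 := by
      rintro w ⟨p, hp, hw⟩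
      have hp0 : p = 0 := by
        rw [← degree_eq_bot]
        by_contra hne
        rw [degree_eq_bot] at hne
        rw [degree_eq_natDegree hne] at hp
        norm_cast at hp
      ext a
      rw [hw a, hp0]; simp
    have hzero : (0 : Fˣ → F) ∈ evalRS F 0 := ⟨0, by simp, by simp⟩
    have e1 : c₁ = 0 := by
      ext ⟨i, j⟩
      exact congrFun (hz _ (hc₁ j)) i
    have e2 : c₂ = 0 := by
      ext ⟨i, j⟩
      exact congrFun (hz _ (hc₂ i)) j
    subst e1 e2
    have hm : (0 : Fˣ × Fˣ → F) ∈
        ((colCode (evalRS F 0) : Set (Fˣ × Fˣ → F)) ∩ rowCode (evalRS F 0)) :=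
      ⟨fun j => hzero, fun i => hzero⟩
    have h1 := distTo_le (0 : Fˣ × Fˣ → F) 0 _ hm
    have h2 : normWt ((0 : Fˣ × Fˣ → F) - 0) = 0 := by simp [normWt_eq]
    rw [h2] at h1 ⊢
    simpa using h1
  · choose r hrd hr using hc₁
    choose c hcd hc using hc₂
    have hrd' := fun y => natDegree_le_of_degree_lt (hrd y)
    have hcd' := fun x => natDegree_le_of_degree_lt (hcd x)
    set n := Fintype.card Fˣ with hn
    have hnpos : (0 : ℝ) < n := by exact_mod_cast (by omega : 0 < n)
    have hfilt : (Finset.univ.filter fun p : Fˣ × Fˣ => (c₁ - c₂) p ≠ 0) =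
        Finset.univ.filter fun p : Fˣ × Fˣ =>
          (r p.2).eval (p.1 : F) ≠ (c p.1).eval (p.2 : F) := by
      ext ⟨i, j⟩
      simp only [Finset.mem_filter, Finset.mem_univ, true_and, Pi.sub_apply, sub_ne_zero]
      have h1 : c₁ (i, j) = (r j).eval (i : F) := hr j i
      have h2 : c₂ (i, j) = (c i).eval (j : F) := hc i j
      rw [h1, h2]
    have hcard2 : (Fintype.card (Fˣ × Fˣ) : ℝ) = n * n := by
      rw [Fintype.card_prod]; push_cast; rfl
    set N := (Finset.univ.filter fun p : Fˣ × Fˣ =>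
          (r p.2).eval (p.1 : F) ≠ (c p.1).eval (p.2 : F)).card with hN
    have hwt : normWt (c₁ - c₂) = (N : ℝ) / (n * n) := by
      rw [normWt_eq, hfilt, hcard2]
    have hNe : N < (n / 2 - k + 1) * (n / 2 - k + 1) := by
      rw [hwt] at hδ
      have h1 : (N : ℝ) ≤ ((n : ℝ) / 2 - k) ^ 2 := by
        rw [div_le_iff₀ (by positivity)] at hδ
        refine hδ.trans (le_of_eq ?_)
        field_simp
      have h2 : (n : ℝ) / 2 - k < ((n / 2 - k + 1 : ℕ) : ℝ) := by
        have h3 : n < 2 * (n / 2 - k + 1) + 2 * k := by omega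
        have h4 : (n : ℝ) < 2 * ((n / 2 - k + 1 : ℕ) : ℝ) + 2 * k := by exact_mod_cast h3
        linarith
      have h5 : (0 : ℝ) ≤ (n : ℝ) / 2 - k := by
        have : (2 * k : ℝ) < n := by exact_mod_cast hk
        linarith
      have h6 : (N : ℝ) < ((n / 2 - k + 1 : ℕ) : ℝ) * ((n / 2 - k + 1 : ℕ) : ℝ) := by nlinarith
      exact_mod_cast h6
    obtain ⟨Q, hQ, hQs, hQr, hQc⟩ := PS.ps (fun x : Fˣ => (x : F)) Units.val_injective (k - 1)
      (n / 2 - k) r c hrd' hcd' (by omega) hNe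
    let q : Fˣ × Fˣ → F := fun p => (Q.eval (C (p.1 : F))).eval (p.2 : F)
    have hqm : q ∈ ((colCode (evalRS F k) : Set (Fˣ × Fˣ → F)) ∩ rowCode (evalRS F k)) := by
      constructor
      · intro j
        refine ⟨Q.map (evalRingHom (j : F)), ?_, fun a => (PS.eval_eval_comm _ _ _).symm⟩
        exact degree_lt_of_natDegree_le hk0 (natDegree_map_le.trans hQ)
      · intro i
        refine ⟨Q.eval (C (i : F)), ?_, fun a => rfl⟩
        exact degree_lt_of_natDegree_le hk0 ((PS.natDegree_eval_C_le _ _).trans hQs)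
    have fin : ∀ w : Fˣ × Fˣ → F,
        (Finset.univ.filter fun p => (w - q) p ≠ 0).card ≤ 2 * N →
        distTo w ((colCode (evalRS F k) : Set (Fˣ × Fˣ → F)) ∩ rowCode (evalRS F k)) ≤
          2 * normWt (c₁ - c₂) := by
      intro w hw
      refine (distTo_le w q _ hqm).trans ?_
      rw [hwt, normWt_eq, hcard2, ← mul_div_assoc]
      apply div_le_div_of_nonneg_right _ (by positivity)
      exact_mod_cast hw
    classical
    constructor
    · apply fin
      have := PS.counting (fun x y : Fˣ => (r y).eval (x : F)) (fun x y : Fˣ => (c x).eval (y : F))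
        (fun x y : Fˣ => q (x, y)) (k - 1) (n / 2 - k) (by omega) ?_ ?_
      · convert this using 2
        ext ⟨i, j⟩
        simp only [Finset.mem_filter, Finset.mem_univ, true_and, Pi.sub_apply, sub_ne_zero]
        have h1 : c₁ (i, j) = (r j).eval (i : F) := hr j i
        rw [h1]
      · refine le_trans (Finset.card_le_card ?_) hQc
        intro x
        simp only [Finset.mem_filter, Finset.mem_univ, true_and]
        rintro ⟨y, hy⟩ h
        exact hy (congrArg (eval (y : F)) h)
      · intro y
        have := eq_or_card_le (r y) (Q.map (evalRingHom (y : F))) (k - 1) (hrd' y)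
          (natDegree_map_le.trans hQ)
        simpa only [PS.eval_eval_comm] using this
    · apply fin
      have := PS.counting (fun y x : Fˣ => (c x).eval (y : F)) (fun y x : Fˣ => (r y).eval (x : F))
        (fun y x : Fˣ => q (x, y)) (k - 1) (n / 2 - k) (by omega) ?_ ?_
      · have s1 : (Finset.univ.filter fun p : Fˣ × Fˣ => (c₂ - q) p ≠ 0).card =
            (Finset.univ.filter fun p : Fˣ × Fˣ => (c p.2).eval (p.1 : F) ≠ q (p.2, p.1)).card := by
          refine Finset.card_equiv (Equiv.prodComm _ _) ?_
          rintro ⟨i, j⟩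
          have h2 : c₂ (i, j) = (c i).eval (j : F) := hc i j
          simp [sub_eq_zero, h2]
        have s2 : N = (Finset.univ.filter fun p : Fˣ × Fˣ =>
            (c p.2).eval (p.1 : F) ≠ (r p.1).eval (p.2 : F)).card := by
          refine Finset.card_equiv (Equiv.prodComm _ _) ?_
          rintro ⟨i, j⟩
          simp [eq_comm]
        rw [s1, s2]
        exact this
      · refine le_trans (Finset.card_le_card ?_) hQr
        intro y
        simp only [Finset.mem_filter, Finset.mem_univ, true_and]
        rintro ⟨x, hx⟩ h
        apply hx
        rw [← h]
        exact (PS.eval_eval_comm _ _ _).symm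
      · intro x
        exact eq_or_card_le (c x) (Q.eval (C (x : F))) (k - 1) (hcd' x)
          ((PS.natDegree_eval_C_le _ _).trans hQs)

end
end

section
/- Let C be the [n, n/3] primitive Reed–Solomon code over F_q with n = q − 1 and 3 | n. Then the axis-parallel line test for C ⊗ C is (1/72)-robust: for every x ∈ F_q^{n×n}, δ(x, C ⊗ C) ≤ 36·(δ(x, C ⊗ F_q^n) + δ(x, F_q^n ⊗ C)). -/
noncomputable section

open Polynomial

theorem ps_coeff_swap {F : Type*} [Field F] (p : F[X][X]) (i j : ℕ) :
    ((Bivariate.swap p).coeff i).coeff j = (p.coeff j).coeff i := by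
  induction p using Polynomial.induction_on' with
  | add p q hp hq => simp [hp, hq]
  | monomial n a =>
    induction a using Polynomial.induction_on' with
    | add p q hp hq => simp only [map_add, coeff_add, hp, hq]
    | monomial m r =>
      rw [Bivariate.swap_monomial_monomial]
      simp only [coeff_monomial]
      split_ifs <;> simp_all [coeff_monomial]

theorem ps_natDegree_swap_le_iff {F : Type*} [Field F] (p : F[X][X]) (b : ℕ) :
    (Bivariate.swap p).natDegree ≤ b ↔ ∀ j, (p.coeff j).natDegree ≤ b := by
  simp only [natDegree_le_iff_coeff_eq_zero]
  constructor
  · intro h j N hN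
    rw [← ps_coeff_swap, h N hN, coeff_zero]
  · intro h N hN
    ext j
    rw [ps_coeff_swap, h j N hN, coeff_zero]

theorem ps_eval_swap {F : Type*} [Field F] (p : F[X][X]) (x : F) :
    (Bivariate.swap p).eval (C x) = p.map (evalRingHom x) := by
  induction p using Polynomial.induction_on' with
  | add p q hp hq => simp [hp, hq]
  | monomial n a =>
    rw [Bivariate.swap_monomial]
    simp [eval_map, C_mul_X_pow_eq_monomial]

theorem ps_natDegree_resultant_le {F : Type*} [Field F] (f g : F[X][X]) (m n b c : ℕ)
    (hf : ∀ j, (f.coeff j).natDegree ≤ b) (hg : ∀ j, (g.coeff j).natDegree ≤ c) :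
    (resultant f g m n).natDegree ≤ m * c + n * b := by
  rw [resultant, Matrix.det_apply]
  refine natDegree_sum_le_of_forall_le _ _ fun σ _ => ?_
  refine (natDegree_smul_le _ _).trans ?_
  refine (natDegree_prod_le _ _).trans ?_
  rw [Fin.sum_univ_add]
  refine add_le_add ?_ ?_
  · refine (Finset.sum_le_card_nsmul _ _ c fun i _ => ?_).trans (by simp)
    simp only [sylvester, Matrix.of_apply, Fin.addCases_left]
    split_ifs
    · exact hg _
    · simp
  · refine (Finset.sum_le_card_nsmul _ _ b fun i _ => ?_).trans (by simp)
    simp only [sylvester, Matrix.of_apply, Fin.addCases_right]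
    split_ifs
    · exact hf _
    · simp

theorem ps_resultant_ne_zero {F : Type*} [Field F] (f g : F[X][X]) (n : ℕ)
    (hf : f ≠ 0) (hg : g.natDegree ≤ n) (h : IsRelPrime f g) :
    resultant f g f.natDegree n ≠ 0 := by
  intro h0
  obtain ⟨v, hv, hv0⟩ := Matrix.exists_mulVec_eq_zero_iff.mpr h0
  have key := toMatrix_sylvesterMap' (m := f.natDegree) (n := n) f g le_rfl hg
  set b₁ := (((degreeLT.basis F[X] f.natDegree).prod (degreeLT.basis F[X] n)).reindex finSumFinEquiv)
  set b₂ := degreeLT.basis F[X] (f.natDegree + n)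
  set w := b₁.equivFun.symm v with hw
  have hwv : b₁.repr w = v := by
    have := b₁.equivFun.apply_symm_apply v
    exact this
  have hw0 : w ≠ 0 := by
    intro h; apply hv; rw [← hwv, h]; simp
  have h1 := LinearMap.toMatrix_mulVec_repr b₁ b₂ (sylvesterMap f g le_rfl hg) w
  rw [key, hwv, hv0] at h1
  have h2 : sylvesterMap f g le_rfl hg w = 0 := by
    apply b₂.repr.injective
    ext i
    rw [← h1]; simp
  obtain ⟨⟨p, hp⟩, ⟨q, hq⟩⟩ := w
  have h3 : f * q + g * p = 0 := congrArg Subtype.val h2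
  have h4 : f ∣ g * p := ⟨-q, by linear_combination h3⟩
  have h5 : f ∣ p := h.dvd_of_dvd_mul_left h4
  rw [mem_degreeLT] at hp
  have hp0 : p = 0 := by
    by_contra hp0
    have := degree_le_of_dvd h5 hp0
    rw [degree_eq_natDegree hf] at this
    exact absurd hp (not_lt.mpr this)
  subst hp0
  have hq0 : q = 0 := by simpa [hf] using h3
  subst hq0
  exact hw0 rfl

theorem ps_lemA {F : Type*} [Field F] [DecidableEq F] (f g : F[X][X]) (d b : ℕ) (hf : f ≠ 0)
    (h : IsRelPrime f g) (hg : g.natDegree ≤ f.natDegree + d)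
    (hfb : (Bivariate.swap f).natDegree ≤ b) (hgb : (Bivariate.swap g).natDegree ≤ b + d)
    (S : Finset F)
    (hS : ∀ s ∈ S, ∃ r : F[X], r.natDegree ≤ d ∧
      g.map (evalRingHom s) = f.map (evalRingHom s) * r) :
    f.natDegree * S.card ≤ f.natDegree * (b + d) + (f.natDegree + d) * b := by
  have hne := ps_resultant_ne_zero f g _ hf hg h
  have hdeg := ps_natDegree_resultant_le f g f.natDegree (f.natDegree + d) b (b + d)
    ((ps_natDegree_swap_le_iff f b).1 hfb) ((ps_natDegree_swap_le_iff g (b + d)).1 hgb)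
  have hdvd : ∏ s ∈ S, (X - C s) ^ f.natDegree ∣ resultant f g f.natDegree (f.natDegree + d) := by
    apply Finset.prod_dvd_of_coprime
    · intro s _ t _ hst
      exact (pairwise_coprime_X_sub_C Function.injective_id hst).pow
    · intro s hs
      obtain ⟨r, hr, hrs⟩ := hS s hs
      have h1 : C (X - C s) ∣ g + f * (-(r.map C)) := by
        rw [C_dvd_iff_dvd_coeff]
        intro i
        rw [dvd_iff_isRoot, IsRoot]
        have : (g + f * (-(r.map C))).map (evalRingHom s) = 0 := by
          simp only [Polynomial.map_add, Polynomial.map_mul, Polynomial.map_neg, hrs,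
            Polynomial.map_map]
          have : (evalRingHom s).comp C = RingHom.id F := by ext; simp
          rw [this, Polynomial.map_id]; ring
        have := congrArg (fun p => coeff p i) this
        simp only [coeff_map, coeff_zero] at this
        exact this
      obtain ⟨u, hu⟩ := h1
      have h2 := resultant_add_mul_right f g (-(r.map C)) f.natDegree (f.natDegree + d)
        (by rw [natDegree_neg]; have := natDegree_map_le (f := (C : F →+* F[X])) (p := r); omega) le_rfl
      rw [hu, resultant_C_mul_right] at h2
      exact ⟨_, h2.symm⟩
  have h3 := (natDegree_le_of_dvd hdvd hne).trans hdeg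
  rw [natDegree_prod _ _ (fun s _ => pow_ne_zero _ (X_sub_C_ne_zero s))] at h3
  simp only [natDegree_pow, natDegree_X_sub_C, Finset.sum_const, smul_eq_mul, mul_one] at h3
  rw [mul_comm]
  exact h3

/-- number of vertical lines on which G vanishes -/
theorem ps_card_vanish {F : Type*} [Field F] [DecidableEq F] (G : F[X][X]) (hG : G ≠ 0)
    (S : Finset F) :
    (S.filter fun s => G.map (evalRingHom s) = 0).card ≤ (Bivariate.swap G).natDegree := by
  have h : G.leadingCoeff ≠ 0 := leadingCoeff_ne_zero.mpr hG
  have h1 := (ps_natDegree_swap_le_iff G _).1 le_rfl G.natDegree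
  refine le_trans ?_ h1
  refine le_trans ?_ (card_roots' _)
  refine le_trans ?_ (Multiset.toFinset_card_le _)
  apply Finset.card_le_card
  intro s hs
  rw [Finset.mem_filter] at hs
  rw [Multiset.mem_toFinset]
  refine (mem_roots h).2 ?_
  have := congrArg (fun p => coeff p G.natDegree) hs.2
  simpa using this

theorem ps_lemB1 {F : Type*} [Field F] [DecidableEq F] (E P E' P' G : F[X][X]) (d : ℕ)
    (hE : E ≠ 0) (hP : P ≠ 0) (h : IsRelPrime E' P') (hGE : G * E' = E) (hGP : G * P' = P)
    (hle : (Bivariate.swap E').natDegree ≤ E'.natDegree)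
    (hPd : P.natDegree ≤ E.natDegree + d)
    (hPd' : (Bivariate.swap P).natDegree ≤ (Bivariate.swap E).natDegree + d)
    (S : Finset F) (hS : ∀ s ∈ S, ∃ r : F[X], r.natDegree ≤ d ∧
      P.map (evalRingHom s) = E.map (evalRingHom s) * r)
    (hcard : 2 * ((Bivariate.swap E).natDegree + d) < S.card) :
    E'.natDegree = 0 := by
  subst hGE hGP
  obtain ⟨hG, hE'⟩ := mul_ne_zero_iff.1 hE
  have hP' := (mul_ne_zero_iff.1 hP).2
  have inj : ∀ p : F[X][X], p ≠ 0 → Bivariate.swap p ≠ 0 := fun p hp =>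
    (map_ne_zero_iff _ (Bivariate.swap (R := F)).injective).2 hp
  rw [natDegree_mul hG hE', natDegree_mul hG hP'] at hPd
  rw [map_mul, map_mul, natDegree_mul (inj _ hG) (inj _ hE'),
    natDegree_mul (inj _ hG) (inj _ hP')] at hPd'
  rw [map_mul, natDegree_mul (inj _ hG) (inj _ hE')] at hcard
  have hv := ps_card_vanish G hG S
  have hsplit := Finset.card_filter_add_card_filter_not (s := S)
    (fun s => G.map (evalRingHom s) = 0)
  have key := ps_lemA E' P' d (Bivariate.swap E').natDegree hE' h (by omega) le_rfl (by omega)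
    (S.filter fun s => ¬ G.map (evalRingHom s) = 0) (by
      intro s hs
      rw [Finset.mem_filter] at hs
      obtain ⟨r, hr, hrs⟩ := hS s hs.1
      refine ⟨r, hr, ?_⟩
      rw [Polynomial.map_mul, Polynomial.map_mul, mul_assoc] at hrs
      exact mul_left_cancel₀ hs.2 hrs)
  by_contra h0
  have h0' : 0 < E'.natDegree := Nat.pos_of_ne_zero h0
  set m := E'.natDegree
  set b := (Bivariate.swap E').natDegree
  set N := (S.filter fun s => ¬ G.map (evalRingHom s) = 0).card
  have hN : 2 * (b + d) + 1 ≤ N := by omega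
  nlinarith [Nat.mul_le_mul_left m hN, Nat.mul_le_mul_left d hle]

theorem ps_lemB {F : Type*} [Field F] [DecidableEq F] (E P : F[X][X]) (d : ℕ)
    (hE : E ≠ 0)
    (hPd : P.natDegree ≤ E.natDegree + d)
    (hPd' : (Bivariate.swap P).natDegree ≤ (Bivariate.swap E).natDegree + d)
    (S : Finset F) (hS : ∀ s ∈ S, ∃ r : F[X], r.natDegree ≤ d ∧
      P.map (evalRingHom s) = E.map (evalRingHom s) * r)
    (hcard : 2 * ((Bivariate.swap E).natDegree + d) < S.card)
    (hS' : ∀ s ∈ S, ∃ r : F[X], r.natDegree ≤ d ∧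
      P.eval (C s) = E.eval (C s) * r)
    (hcard' : 2 * (E.natDegree + d) < S.card) : E ∣ P := by
  by_cases hP : P = 0
  · simp [hP]
  obtain ⟨E', P', G, h, hGE, hGP⟩ := UniqueFactorizationMonoid.exists_reduced_factors E hE P
  have inj : ∀ p : F[X][X], p ≠ 0 → Bivariate.swap p ≠ 0 := fun p hp =>
    (map_ne_zero_iff _ (Bivariate.swap (R := F)).injective).2 hp
  have hss : ∀ p : F[X][X], Bivariate.swap (Bivariate.swap p) = p := Bivariate.swap_swap_apply
  have hh : E'.natDegree = 0 ∧ (Bivariate.swap E').natDegree = 0 := by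
    rcases le_total (Bivariate.swap E').natDegree E'.natDegree with hle | hle
    · have := ps_lemB1 E P E' P' G d hE hP h hGE hGP hle hPd hPd' S hS hcard
      omega
    · have := ps_lemB1 (Bivariate.swap E) (Bivariate.swap P) (Bivariate.swap E') (Bivariate.swap P')
        (Bivariate.swap G) d (inj _ hE) (inj _ hP) (by
          intro u hu hv
          have := h (d := Bivariate.swap u)
            (by have := map_dvd (Bivariate.swap (R := F)) hu; rwa [hss] at this)
            (by have := map_dvd (Bivariate.swap (R := F)) hv; rwa [hss] at this)
          have := this.map (Bivariate.swap (R := F))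
          rwa [hss] at this)
        (by rw [← map_mul, hGE]) (by rw [← map_mul, hGP]) (by rwa [hss]) hPd'
        (by rwa [hss, hss]) S (by
          intro s hs
          obtain ⟨r, hr, hrs⟩ := hS' s hs
          refine ⟨r, hr, ?_⟩
          rwa [← ps_eval_swap, ← ps_eval_swap, hss, hss]) (by rwa [hss])
      omega
  have hE' : E' ≠ 0 := by rintro rfl; exact hE (by rw [← hGE, mul_zero])
  have hunit : IsUnit E' := by
    have h1 := (ps_natDegree_swap_le_iff E' 0).1 hh.2.le 0
    rw [eq_C_of_natDegree_eq_zero hh.1] at hE' ⊢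
    rw [eq_C_of_natDegree_le_zero h1] at hE' ⊢
    have : (E'.coeff 0).coeff 0 ≠ 0 := by
      intro h; apply hE'; simp [h]
    exact ((IsUnit.mk0 _ this).map C).map C
  obtain ⟨u, hu⟩ := hunit
  refine ⟨↑u⁻¹ * P', ?_⟩
  rw [← hGE, ← hGP, ← hu, mul_assoc, ← mul_assoc (u : F[X][X]), Units.mul_inv, one_mul]

theorem ps_lemC {F : Type*} [Field F] [DecidableEq F] (E : F[X][X]) (d a : ℕ)
    (hE : E ≠ 0) (hEa : E.natDegree ≤ a) (hEa' : (Bivariate.swap E).natDegree ≤ a)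
    (S : Finset F) (hcard : 2 * (a + d) < S.card) (R T : F → F[X])
    (hR : ∀ s ∈ S, (R s).natDegree ≤ d) (hT : ∀ s ∈ S, (T s).natDegree ≤ d)
    (hRT : ∀ s ∈ S, ∀ t ∈ S, evalEval s t E * (R s).eval t = evalEval s t E * (T t).eval s) :
    ∃ Q : F[X][X], Q.natDegree ≤ d ∧ (Bivariate.swap Q).natDegree ≤ d ∧
      ∀ s ∈ S, E.map (evalRingHom s) ≠ 0 → Q.map (evalRingHom s) = R s := by
  have hss : ∀ p : F[X][X], Bivariate.swap (Bivariate.swap p) = p := Bivariate.swap_swap_apply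
  have hcomp : ∀ s : F, (evalRingHom s).comp C = RingHom.id F := fun s => by ext; simp
  have hinj : Set.InjOn (id : F → F) S := Function.injective_id.injOn
  set P : F[X][X] := ∑ s ∈ S, C (Lagrange.basis S id s) * (E.map (evalRingHom s) * R s).map C
    with hPdef
  have hPs : ∀ t ∈ S, P.map (evalRingHom t) = E.map (evalRingHom t) * R t := by
    intro t ht
    rw [hPdef, Polynomial.map_sum, Finset.sum_eq_single t]
    · have h1 := Lagrange.eval_basis_self hinj ht
      simp only [id] at h1
      rw [Polynomial.map_mul, Polynomial.map_map, hcomp, Polynomial.map_id, map_C]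
      simp [h1]
    · intro s hs hst
      have h1 := Lagrange.eval_basis_of_ne (s := S) (v := id) hst ht
      simp only [id] at h1
      rw [Polynomial.map_mul, map_C]
      simp [h1]
    · intro h; exact absurd ht h
  have hPd : P.natDegree ≤ E.natDegree + d := by
    refine natDegree_sum_le_of_forall_le _ _ fun s hs => ?_
    refine (natDegree_C_mul_le _ _).trans ?_
    refine (natDegree_map_le).trans ?_
    refine natDegree_mul_le.trans ?_
    exact add_le_add natDegree_map_le (hR s hs)
  have hevE : ∀ t, (E.eval (C t)).natDegree ≤ (Bivariate.swap E).natDegree := by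
    intro t
    rw [← hss E, ps_eval_swap, hss]
    exact natDegree_map_le
  have hPt : ∀ t ∈ S, P.eval (C t) = E.eval (C t) * T t := by
    intro t ht
    refine eq_of_degrees_lt_of_eval_finset_eq S ?_ ?_ ?_
    · rw [hPdef, eval_finsetSum]
      refine (degree_sum_le _ _).trans_lt ?_
      rw [Finset.sup_lt_iff (by simp [bot_lt_iff_ne_bot])]
      intro s hs
      rw [eval_mul, eval_C, eval_map_apply]
      refine (degree_mul_le _ _).trans_lt ?_
      rw [Lagrange.degree_basis hinj hs]
      refine lt_of_le_of_lt (add_le_add le_rfl degree_C_le) ?_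
      rw [add_zero]
      have : 0 < S.card := by omega
      exact_mod_cast (by omega : S.card - 1 < S.card)
    · refine degree_le_natDegree.trans_lt ?_
      have h1 := natDegree_mul_le (p := E.eval (C t)) (q := T t)
      have h2 := hevE t
      have h3 := hT t ht
      exact_mod_cast (by omega : (E.eval (C t) * T t).natDegree < S.card)
    · intro s hs
      have h1 : eval s (eval (C t) P) = eval t (P.map (evalRingHom s)) :=
        (map_evalRingHom_eval s t P).symm
      have h2 : eval s (eval (C t) E) = eval t (E.map (evalRingHom s)) :=
        (map_evalRingHom_eval s t E).symm
      have h3 := hRT s hs t ht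
      simp only [evalEval] at h3
      rw [h1, hPs s hs, eval_mul, eval_mul, ← h3, h2]
  have hPd' : (Bivariate.swap P).natDegree ≤ (Bivariate.swap E).natDegree + d := by
    rw [natDegree_le_iff_coeff_eq_zero]
    intro N hN
    refine eq_zero_of_degree_lt_of_eval_finset_eq_zero S ?_ ?_
    · refine degree_le_natDegree.trans_lt ?_
      have h1 := (ps_natDegree_swap_le_iff (Bivariate.swap P) (E.natDegree + d)).1 (by rw [hss]; exact hPd) N
      exact_mod_cast (by omega : ((Bivariate.swap P).coeff N).natDegree < S.card)
    · intro t ht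
      have h1 : (P.eval (C t)).coeff N = 0 := by
        apply coeff_eq_zero_of_natDegree_lt
        rw [hPt t ht]
        have h1 := natDegree_mul_le (p := E.eval (C t)) (q := T t)
        have h2 := hevE t
        have h3 := hT t ht
        omega
      rw [← hss P, ps_eval_swap, coeff_map] at h1
      exact h1
  obtain ⟨Q, hQ⟩ := ps_lemB E P d hE hPd hPd' S (fun s hs => ⟨R s, hR s hs, hPs s hs⟩) (by omega)
    (fun s hs => ⟨T s, hT s hs, hPt s hs⟩) (by omega)
  have inj : ∀ p : F[X][X], p ≠ 0 → Bivariate.swap p ≠ 0 := fun p hp =>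
    (map_ne_zero_iff _ (Bivariate.swap (R := F)).injective).2 hp
  refine ⟨Q, ?_, ?_, ?_⟩
  · by_cases h0 : Q = 0
    · simp [h0]
    rw [hQ, natDegree_mul hE h0] at hPd
    omega
  · by_cases h0 : Q = 0
    · simp [h0]
    rw [hQ, map_mul, natDegree_mul (inj _ hE) (inj _ h0)] at hPd'
    omega
  · intro s hs hs0
    have h1 := hPs s hs
    rw [hQ, Polynomial.map_mul] at h1
    exact mul_left_cancel₀ hs0 h1

theorem ps_exists_locator {F : Type*} [Field F] [DecidableEq F] (T : Finset (F × F)) (a : ℕ)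
    (h : T.card < (a + 1) * (a + 1)) :
    ∃ E : F[X][X], E ≠ 0 ∧ E.natDegree ≤ a ∧ (Bivariate.swap E).natDegree ≤ a ∧
      ∀ p ∈ T, evalEval p.1 p.2 E = 0 := by
  let M : Matrix T (Fin (a + 1) × Fin (a + 1)) F :=
    .of fun p ij => p.1.1 ^ (ij.1 : ℕ) * p.1.2 ^ (ij.2 : ℕ)
  have hker : LinearMap.ker M.mulVecLin ≠ ⊥ := by
    apply LinearMap.ker_ne_bot_of_finrank_lt
    simpa using h
  obtain ⟨v, hv, hv0⟩ := (Submodule.ne_bot_iff _).1 hker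
  have hMv : M.mulVec v = 0 := hv
  let E : F[X][X] := ∑ ij : Fin (a + 1) × Fin (a + 1),
    monomial (ij.2 : ℕ) (monomial (ij.1 : ℕ) (v ij))
  have hcoeff : ∀ i j : Fin (a + 1), (E.coeff j).coeff i = v (i, j) := by
    intro i j
    simp only [E, finsetSum_coeff, coeff_monomial]
    rw [Finset.sum_eq_single (i, j)]
    · simp
    · rintro ⟨i', j'⟩ _ hne
      dsimp only
      split_ifs with h1
      · rw [coeff_monomial, if_neg]
        intro h2
        exact hne (Prod.ext (Fin.ext h2) (Fin.ext h1))
      · simp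
    · simp
  refine ⟨E, ?_, ?_, ?_, ?_⟩
  · intro h0
    apply hv0
    ext ⟨i, j⟩
    rw [← hcoeff, h0]; simp
  · refine natDegree_sum_le_of_forall_le _ _ fun ij _ => ?_
    exact (natDegree_monomial_le _).trans (by omega)
  · simp only [E, map_sum, Bivariate.swap_monomial_monomial]
    refine natDegree_sum_le_of_forall_le _ _ fun ij _ => ?_
    exact (natDegree_monomial_le _).trans (by omega)
  · intro p hp
    have h1 := congrFun hMv ⟨p, hp⟩
    simp only [Matrix.mulVec, dotProduct, M, Matrix.of_apply, Pi.zero_apply] at h1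
    rw [← h1]
    simp only [E, evalEval, eval_finsetSum, eval_monomial, eval_mul, eval_pow, eval_C]
    refine Finset.sum_congr rfl fun ij _ => ?_
    ring

open Finset in
theorem ps_agree {F : Type*} [Field F] [Fintype F] [DecidableEq F] (k : ℕ)
    (hk : Fintype.card Fˣ = 3 * k) (c₁ c₂ : Fˣ × Fˣ → F)
    (h₁ : c₁ ∈ (colCode (evalRS F k) : Set (Fˣ × Fˣ → F)))
    (h₂ : c₂ ∈ (rowCode (evalRS F k) : Set (Fˣ × Fˣ → F)))
    (h : 36 * (univ.filter fun p => c₁ p ≠ c₂ p).card < (3 * k) * (3 * k)) :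
    ∃ q ∈ (colCode (evalRS F k) : Set (Fˣ × Fˣ → F)) ∩ rowCode (evalRS F k),
      (univ.filter fun p => c₁ p ≠ q p).card ≤ 2 * (univ.filter fun p => c₁ p ≠ c₂ p).card := by
  have hkpos : 0 < k := by
    have : 0 < Fintype.card Fˣ := Fintype.card_pos
    omega
  choose T hTd hT using h₁
  choose R hRd hR using h₂
  replace hT : ∀ j a : Fˣ, c₁ (a, j) = eval (a : F) (T j) := hT
  replace hR : ∀ i a : Fˣ, c₂ (i, a) = eval (a : F) (R i) := hR
  have hnd : ∀ p : F[X], p.degree < (k : ℕ) ↔ p.natDegree ≤ k - 1 := by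
    intro p
    constructor
    · intro hp
      by_cases h0 : p = 0
      · simp [h0]
      have := (natDegree_lt_iff_degree_lt h0).2 hp
      omega
    · intro hp
      refine degree_le_natDegree.trans_lt ?_
      exact_mod_cast (by omega : p.natDegree < k)
  set D := univ.filter fun p => c₁ p ≠ c₂ p with hD
  set a := Nat.sqrt D.card with ha
  have ha1 : a * a ≤ D.card := Nat.sqrt_le _
  have ha2 : 2 * a < k := by
    by_contra hc
    push Not at hc
    nlinarith [Nat.mul_le_mul hc hc]
  let emb : Fˣ ↪ F := ⟨Units.val, Units.val_injective⟩
  obtain ⟨E, hE0, hEa, hEa', hET⟩ := ps_exists_locator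
    (D.map (emb.prodMap emb)) a (by rw [card_map]; exact Nat.lt_succ_sqrt _)
  let S : Finset F := univ.map emb
  have hScard : S.card = 3 * k := by simp [S, hk]
  let ext : (Fˣ → F[X]) → F → F[X] := fun f s => if hs : s = 0 then 0 else f (Units.mk0 s hs)
  have hext : ∀ f (u : Fˣ), ext f u = f u := by
    intro f u
    simp [ext]
  obtain ⟨Q, hQ1, hQ2, hQ⟩ := ps_lemC E (k - 1) a hE0 hEa hEa' S (by omega) (ext R) (ext T)
    (by
      intro s hs
      obtain ⟨u, _, rfl⟩ := mem_map.1 hs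
      exact (hext R u).symm ▸ (hnd _).1 (hRd u))
    (by
      intro s hs
      obtain ⟨u, _, rfl⟩ := mem_map.1 hs
      exact (hext T u).symm ▸ (hnd _).1 (hTd u))
    (by
      intro s hs t ht
      obtain ⟨u, _, rfl⟩ := mem_map.1 hs
      obtain ⟨w, _, rfl⟩ := mem_map.1 ht
      change evalEval (u : F) (w : F) E * eval (w : F) (ext R (u : F)) =
        evalEval (u : F) (w : F) E * eval (u : F) (ext T (w : F))
      rw [hext, hext, ← hR, ← hT]
      by_cases hc : c₁ (u, w) = c₂ (u, w)
      · rw [hc]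
      · have : evalEval (u : F) (w : F) E = 0 :=
          hET ((u : F), (w : F)) (mem_map.2 ⟨(u, w), by simp [hD, hc], rfl⟩)
        rw [this]; ring)
  let q : Fˣ × Fˣ → F := fun p => evalEval (p.1 : F) (p.2 : F) Q
  have hqrow : ∀ u w : Fˣ, q (u, w) = eval (w : F) (Q.map (evalRingHom (u : F))) := fun u w =>
    (map_evalRingHom_eval (u : F) (w : F) Q).symm
  have hqcold : ∀ w : Fˣ, (Q.eval (C (w : F))).natDegree ≤ k - 1 := by
    intro w
    rw [← Bivariate.swap_swap_apply Q, ps_eval_swap]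
    refine natDegree_map_le.trans ?_
    exact hQ2
  refine ⟨q, ⟨?_, ?_⟩, ?_⟩
  · intro w
    exact ⟨Q.eval (C (w : F)), (hnd _).2 (hqcold w), fun u => rfl⟩
  · intro u
    exact ⟨Q.map (evalRingHom (u : F)), (hnd _).2 (natDegree_map_le.trans hQ1),
      fun w => hqrow u w⟩
  have hcount : ∀ f : Fˣ × Fˣ → F, (univ.filter fun p => c₁ p ≠ f p).card =
      ∑ w : Fˣ, (univ.filter fun u : Fˣ => c₁ (u, w) ≠ f (u, w)).card := by
    intro f
    simp only [card_filter]
    rw [Fintype.sum_prod_type_right]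
  rw [hcount q, hD, hcount c₂, mul_sum]
  refine sum_le_sum fun w _ => ?_
  by_cases hgood : T w = Q.eval (C (w : F))
  · have : (univ.filter fun u : Fˣ => c₁ (u, w) ≠ q (u, w)) = ∅ := by
      rw [filter_eq_empty_iff]
      intro u _
      rw [not_not, hT w u, hgood]
    rw [this]; simp
  · have hcov : (univ : Finset Fˣ) ⊆
        ((univ.filter fun u : Fˣ => E.map (evalRingHom (u : F)) = 0) ∪
        (univ.filter fun u : Fˣ => c₁ (u, w) = q (u, w))) ∪
        (univ.filter fun u : Fˣ => c₁ (u, w) ≠ c₂ (u, w)) := by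
      intro u _
      simp only [mem_union, mem_filter, mem_univ, true_and]
      by_cases h1 : E.map (evalRingHom (u : F)) = 0
      · exact Or.inl (Or.inl h1)
      by_cases h2 : c₁ (u, w) = q (u, w)
      · exact Or.inl (Or.inr h2)
      right
      have h3 := hQ (u : F) (mem_map.2 ⟨u, mem_univ _, rfl⟩) h1
      rw [hext] at h3
      have h4 : c₂ (u, w) = q (u, w) := by rw [hqrow, h3, ← hR u w]
      rwa [h4]
    have hc1 : (univ.filter fun u : Fˣ => E.map (evalRingHom (u : F)) = 0).card ≤ a := by
      refine le_trans ?_ ((ps_card_vanish E hE0 S).trans hEa')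
      rw [← card_map emb]
      apply card_le_card
      intro s hs
      obtain ⟨u, hu, rfl⟩ := mem_map.1 hs
      exact mem_filter.2 ⟨mem_map.2 ⟨u, mem_univ _, rfl⟩, (mem_filter.1 hu).2⟩
    have hc2 : (univ.filter fun u : Fˣ => c₁ (u, w) = q (u, w)).card ≤ k - 1 := by
      have hne : T w - Q.eval (C (w : F)) ≠ 0 := sub_ne_zero.2 hgood
      have hdeg : (T w - Q.eval (C (w : F))).natDegree ≤ k - 1 :=
        (natDegree_sub_le _ _).trans (max_le ((hnd _).1 (hTd w)) (hqcold w))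
      refine le_trans ?_ ((card_roots' _).trans hdeg)
      refine le_trans ?_ (Multiset.toFinset_card_le _)
      rw [← card_map emb]
      apply card_le_card
      intro s hs
      obtain ⟨u, hu, rfl⟩ := mem_map.1 hs
      rw [Multiset.mem_toFinset, mem_roots hne, IsRoot, eval_sub, sub_eq_zero]
      have h5 := (mem_filter.1 hu).2
      rw [hT w u] at h5
      exact h5
    have hle := card_le_card hcov
    rw [card_univ, hk] at hle
    have hu1 := card_union_le ((univ.filter fun u : Fˣ => E.map (evalRingHom (u : F)) = 0) ∪
        (univ.filter fun u : Fˣ => c₁ (u, w) = q (u, w)))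
        (univ.filter fun u : Fˣ => c₁ (u, w) ≠ c₂ (u, w))
    have hu2 := card_union_le (univ.filter fun u : Fˣ => E.map (evalRingHom (u : F)) = 0)
        (univ.filter fun u : Fˣ => c₁ (u, w) = q (u, w))
    have hall : (univ.filter fun u : Fˣ => c₁ (u, w) ≠ q (u, w)).card ≤ 3 * k := by
      rw [← hk, ← card_univ]; exact card_le_card (filter_subset _ _)
    omega

theorem ps_normWt_sub {ι F : Type*} [Fintype ι] [Field F] [DecidableEq F] (x y : ι → F) :
    normWt (x - y) = ((Finset.univ.filter fun p => x p ≠ y p).card : ℝ) / (Fintype.card ι : ℝ) := by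
  unfold normWt
  congr 2
  rw [Nat.card_eq_fintype_card, Fintype.card_subtype]
  congr 1
  ext p
  simp [sub_eq_zero]

theorem ps_card_tri {ι F : Type*} [Fintype ι] [DecidableEq ι] [DecidableEq F] (x y z : ι → F) :
    (Finset.univ.filter fun p => x p ≠ z p).card ≤
      (Finset.univ.filter fun p => x p ≠ y p).card +
      (Finset.univ.filter fun p => y p ≠ z p).card := by
  refine le_trans (Finset.card_le_card ?_) (Finset.card_union_le _ _)
  intro p hp
  simp only [Finset.mem_union, Finset.mem_filter, Finset.mem_univ, true_and] at hp ⊢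
  by_contra hc
  push Not at hc
  exact hp (hc.1.trans hc.2)

theorem ps_dist_attained {ι F : Type*} [Fintype ι] [Field F] [Finite F] (x : ι → F)
    (S : Set (ι → F)) (hS : S.Nonempty) : ∃ c ∈ S, normWt (x - c) = distTo x S := by
  have hfin : ((fun c => normWt (x - c)) '' S).Finite := (Set.toFinite S).image _
  exact (hS.image _).csInf_mem hfin

theorem ps_dist_le {ι F : Type*} [Fintype ι] [Field F] [Finite F] (x : ι → F)
    (S : Set (ι → F)) (c : ι → F) (hc : c ∈ S) : distTo x S ≤ normWt (x - c) :=
  csInf_le ((Set.toFinite S).image _).bddBelow ⟨c, hc, rfl⟩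

/-- the axis-parallel line test for `C ⊗ C` is `1/72`-robust for the
`[n, n/3]` primitive Reed–Solomon code: `δ(x, C⊗C) ≤ 36(δ(x, C⊗F^n) + δ(x, F^n⊗C))`. -/
theorem stmt_14 {F : Type*} [Field F] [Fintype F] [DecidableEq F] (k : ℕ)
    (hk : Fintype.card Fˣ = 3 * k) (x : Fˣ × Fˣ → F) :
    distTo x ((colCode (evalRS F k) : Set (Fˣ × Fˣ → F)) ∩ rowCode (evalRS F k)) ≤
      36 * (distTo x (colCode (evalRS F k) : Set (Fˣ × Fˣ → F)) +
        distTo x (rowCode (evalRS F k) : Set (Fˣ × Fˣ → F))) := by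
  have hz : (0 : Fˣ → F) ∈ evalRS F k := ⟨0, by simp, by simp⟩
  have hz1 : (0 : Fˣ × Fˣ → F) ∈ (colCode (evalRS F k) : Set (Fˣ × Fˣ → F)) := fun _ => hz
  have hz2 : (0 : Fˣ × Fˣ → F) ∈ (rowCode (evalRS F k) : Set (Fˣ × Fˣ → F)) := fun _ => hz
  obtain ⟨c₁, hc₁, e₁⟩ := ps_dist_attained x _ ⟨_, hz1⟩
  obtain ⟨c₂, hc₂, e₂⟩ := ps_dist_attained x _ ⟨_, hz2⟩
  rw [← e₁, ← e₂, ps_normWt_sub, ps_normWt_sub]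
  have hcardpos : 0 < Fintype.card (Fˣ × Fˣ) := Fintype.card_pos
  have hcard : Fintype.card (Fˣ × Fˣ) = (3 * k) * (3 * k) := by rw [Fintype.card_prod, hk]
  have hposR : (0 : ℝ) < (Fintype.card (Fˣ × Fˣ) : ℝ) := by exact_mod_cast hcardpos
  set d₁ := (Finset.univ.filter fun p => x p ≠ c₁ p).card with hd₁
  set d₂ := (Finset.univ.filter fun p => x p ≠ c₂ p).card with hd₂
  suffices hs : ∃ q ∈ (colCode (evalRS F k) : Set (Fˣ × Fˣ → F)) ∩ rowCode (evalRS F k),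
      (Finset.univ.filter fun p => x p ≠ q p).card ≤ 36 * (d₁ + d₂) by
    obtain ⟨q, hq, hle⟩ := hs
    refine (ps_dist_le x _ q hq).trans ?_
    rw [ps_normWt_sub, ← add_div, ← mul_div_assoc]
    apply div_le_div_of_nonneg_right _ hposR.le
    exact_mod_cast hle
  by_cases hbig : (3 * k) * (3 * k) ≤ 36 * (d₁ + d₂)
  · refine ⟨0, ⟨hz1, hz2⟩, le_trans ?_ hbig⟩
    rw [← hcard, ← Finset.card_univ]
    exact Finset.card_le_card (Finset.filter_subset _ _)
  · have htri := ps_card_tri c₁ x c₂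
    have hsymm : (Finset.univ.filter fun p => c₁ p ≠ x p).card = d₁ := by
      simp only [hd₁, ne_comm]
    rw [hsymm] at htri
    obtain ⟨q, hq, hle⟩ := ps_agree k hk c₁ c₂ hc₁ hc₂ (by omega)
    refine ⟨q, hq, ?_⟩
    have htri2 := ps_card_tri x c₁ q
    omega

end
end
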